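/- Let q ≥ 4 be a prime power, let H = PSL₂(F_q) be the projective special linear group over the field with q elements, and let G = Hᵏ for some k ≥ 1. Then the following are equivalent: (a) G admits an unmixed Beauville structure; (b) G can be generated by two elements and G is not isomorphic to the alternating group on 5 letters; (c) k·|Aut H| ≤ φ₂(H), and if q ≤ 5 then k > 1. -/

import Mathlib

open scoped MatrixGroups

/-- `Σ(T)`: the union of all conjugates of the cyclic subgroups generated by the
three entries of the triple `T = (a, b, c)`. -/
def SigmaSet {G : Type*} [Group G] (T : G × G × G) : Set G :=
  {x | ∃ g : G, g * x * g⁻¹ ∈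
    (Subgroup.zpowers T.1 : Set G) ∪ (Subgroup.zpowers T.2.1 : Set G) ∪
      (Subgroup.zpowers T.2.2 : Set G)}

/-- `T = (a,b,c)` is a generating triple: `a*b*c = 1` and `{a,b,c}` generates. -/
def IsGenTriple {G : Type*} [Group G] (T : G × G × G) : Prop :=
  T.1 * T.2.1 * T.2.2 = 1 ∧ Subgroup.closure {T.1, T.2.1, T.2.2} = ⊤

/-- `T` is hyperbolic: the reciprocals of the orders of its entries sum to less than 1. -/
def IsHyperbolic {G : Type*} [Group G] (T : G × G × G) : Prop :=
  (orderOf T.1 : ℚ)⁻¹ + (orderOf T.2.1 : ℚ)⁻¹ + (orderOf T.2.2 : ℚ)⁻¹ < 1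

/-- An unmixed Beauville structure on `G`: a pair of hyperbolic generating triples
`T₁, T₂` with `Σ(T₁) ∩ Σ(T₂) = {1}`. -/
def HasBeauvilleStructure (G : Type*) [Group G] : Prop :=
  ∃ T₁ T₂ : G × G × G, IsGenTriple T₁ ∧ IsHyperbolic T₁ ∧ IsGenTriple T₂ ∧ IsHyperbolic T₂ ∧
    SigmaSet T₁ ∩ SigmaSet T₂ = {1}

/-- `φ₂(H)`: the number of ordered generating pairs of `H`. -/
noncomputable def phi2 (H : Type*) [Group H] : ℕ :=
  Nat.card {p : H × H // Subgroup.closure {p.1, p.2} = ⊤}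

/-- Two triples are equivalent if some automorphism carries one to the other entrywise. -/
def TripleEquiv {H : Type*} [Group H] (T T' : H × H × H) : Prop :=
  ∃ α : MulAut H, α T.1 = T'.1 ∧ α T.2.1 = T'.2.1 ∧ α T.2.2 = T'.2.2

section Products

variable {H : Type*} [Group H]

/-- Two pairs lie in the same orbit of the automorphism group. -/
def PairEquiv (p q : H × H) : Prop := ∃ α : MulAut H, α p.1 = q.1 ∧ α p.2 = q.2

theorem PairEquiv.symm {p q : H × H} : PairEquiv p q → PairEquiv q p := by
  rintro ⟨α, h1, h2⟩
  exact ⟨α⁻¹, by simp [← h1], by simp [← h2]⟩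

theorem exists_mulAut_of_normal_trace [IsSimpleGroup H] {K : Type*} [Group K] (f g : K →* H)
    (hf : Function.Surjective f) (hg : Function.Surjective g) (h : f.ker ≤ g.ker) :
    ∃ α : MulAut H, ∀ x, α (f x) = g x := by
  let φ : H →* H := f.liftOfSurjective hf ⟨g, h⟩
  have hφ : ∀ x, φ (f x) = g x := fun x =>
    f.liftOfRightInverse_comp_apply _ (Function.rightInverse_surjInv hf) ⟨g, h⟩ x
  have hs : Function.Surjective φ := fun y => by
    obtain ⟨x, rfl⟩ := hg y
    exact ⟨f x, hφ x⟩
  have hi : Function.Injective φ := by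
    rw [← MonoidHom.ker_eq_bot_iff]
    rcases φ.normal_ker.eq_bot_or_eq_top with h | h
    · exact h
    · exfalso
      obtain ⟨y, hy⟩ := exists_ne (1 : H)
      obtain ⟨x, rfl⟩ := hs y
      exact hy (MonoidHom.mem_ker.1 (h ▸ Subgroup.mem_top x))
  exact ⟨MulEquiv.ofBijective φ ⟨hi, hs⟩, hφ⟩

theorem closure_pair_pi_eq_top [IsSimpleGroup H] (hna : ∃ a b : H, a * b ≠ b * a)
    {ι : Type*} [Finite ι] (x y : ι → H) (hgen : ∀ i, Subgroup.closure {x i, y i} = ⊤)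
    (hineq : ∀ i j, i ≠ j → ¬ PairEquiv (x i, y i) (x j, y j)) :
    Subgroup.closure {x, y} = ⊤ := by
  classical
  set K := Subgroup.closure {x, y} with hK
  have hx : x ∈ K := Subgroup.subset_closure (by simp)
  have hy : y ∈ K := Subgroup.subset_closure (by simp)
  have hsurj : ∀ i h, ∃ g ∈ K, g i = h := by
    intro i h
    have : K.map (Pi.evalMonoidHom (fun _ => H) i) = ⊤ := by
      rw [eq_top_iff, ← hgen i, Subgroup.closure_le]
      rintro z (rfl | rfl)
      · exact ⟨x, hx, rfl⟩
      · exact ⟨y, hy, rfl⟩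
    obtain ⟨g, hg, rfl⟩ := (this ▸ Subgroup.mem_top h : h ∈ K.map _)
    exact ⟨g, hg, rfl⟩
  -- the normal subgroup of values at `j` of the elements of `K` trivial on `S`
  let N : Set ι → ι → Subgroup H := fun S j =>
    { carrier := {h | ∃ g ∈ K, (∀ i ∈ S, g i = 1) ∧ g j = h}
      one_mem' := ⟨1, K.one_mem, fun _ _ => rfl, rfl⟩
      mul_mem' := by
        rintro a b ⟨g, hg, hg1, rfl⟩ ⟨g', hg', hg1', rfl⟩
        exact ⟨g * g', K.mul_mem hg hg', fun i hi => by simp [hg1 i hi, hg1' i hi], rfl⟩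
      inv_mem' := by
        rintro a ⟨g, hg, hg1, rfl⟩
        exact ⟨g⁻¹, K.inv_mem hg, fun i hi => by simp [hg1 i hi], rfl⟩ }
  have hN : ∀ S j, (N S j).Normal := by
    intro S j
    constructor
    rintro _ ⟨g, hg, hg1, rfl⟩ b
    obtain ⟨g', hg', rfl⟩ := hsurj j b
    exact ⟨g' * g * g'⁻¹, K.mul_mem (K.mul_mem hg' hg) (K.inv_mem hg'),
      fun i hi => by simp [hg1 i hi], rfl⟩
  have hpair : ∀ i j, i ≠ j → N {i} j = ⊤ := by
    intro i j hij
    rcases (hN {i} j).eq_bot_or_eq_top with h | h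
    · exfalso
      let f : K →* H := (Pi.evalMonoidHom (fun _ => H) i).comp K.subtype
      let g : K →* H := (Pi.evalMonoidHom (fun _ => H) j).comp K.subtype
      obtain ⟨α, hα⟩ := exists_mulAut_of_normal_trace f g
        (fun z => by obtain ⟨w, hw, rfl⟩ := hsurj i z; exact ⟨⟨w, hw⟩, rfl⟩)
        (fun z => by obtain ⟨w, hw, rfl⟩ := hsurj j z; exact ⟨⟨w, hw⟩, rfl⟩)
        (fun z hz => by
          have : (z : ι → H) j ∈ N {i} j := ⟨z, z.2, fun i' hi' => by
            rw [Set.mem_singleton_iff.1 hi']; exact hz, rfl⟩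
          rw [h, Subgroup.mem_bot] at this
          exact this)
      exact hineq i j hij ⟨α, hα ⟨x, hx⟩, hα ⟨y, hy⟩⟩
    · exact h
  have hall : ∀ (S : Finset ι) (j : ι), j ∉ S → N (S : Set ι) j = ⊤ := by
    intro S j
    induction S using Finset.induction_on with
    | empty =>
      intro _
      rw [eq_top_iff]
      intro h _
      obtain ⟨g, hg, rfl⟩ := hsurj j h
      exact ⟨g, hg, by simp, rfl⟩
    | insert i S hi ih =>
      intro hj
      rw [Finset.mem_insert, not_or] at hj
      rcases (hN (insert i S : Finset ι) j).eq_bot_or_eq_top with h | h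
      · exfalso
        obtain ⟨a, b, hab⟩ := hna
        obtain ⟨g, hg, hg1, rfl⟩ : a ∈ N S j := ih hj.2 ▸ Subgroup.mem_top a
        obtain ⟨g', hg', hg1', rfl⟩ : b ∈ N {i} j := hpair i j (Ne.symm hj.1) ▸ Subgroup.mem_top b
        have : g j * g' j * (g j)⁻¹ * (g' j)⁻¹ ∈ N (insert i S : Finset ι) j := by
          refine ⟨g * g' * g⁻¹ * g'⁻¹, K.mul_mem (K.mul_mem (K.mul_mem hg hg') (K.inv_mem hg))
            (K.inv_mem hg'), ?_, rfl⟩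
          intro i' hi'
          rw [Finset.coe_insert, Set.mem_insert_iff] at hi'
          rcases hi' with rfl | hi'
          · simp [hg1' i' rfl]
          · simp [hg1 i' hi']
        rw [h, Subgroup.mem_bot, mul_inv_eq_one, mul_inv_eq_iff_eq_mul] at this
        exact hab this
      · exact h
  have := Fintype.ofFinite ι
  have hsingle : ∀ j, Subgroup.map (MonoidHom.mulSingle (fun _ : ι => H) j) ⊤ ≤ K := by
    rintro j _ ⟨h, -, rfl⟩
    obtain ⟨g, hg, hg1, rfl⟩ : h ∈ N (Finset.univ.erase j : Finset ι) j :=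
      hall (Finset.univ.erase j) j (by simp) ▸ Subgroup.mem_top h
    convert hg
    ext i
    rw [MonoidHom.mulSingle_apply]
    by_cases hij : i = j
    · subst hij; simp
    · simp [hij, hg1 i (by simp [hij])]
  rw [eq_top_iff, ← Subgroup.pi_top Set.univ]
  exact Subgroup.pi_le_iff.2 hsingle

theorem mulAut_eq_of_pair {x y : H} (hgen : Subgroup.closure {x, y} = ⊤) {α β : MulAut H}
    (h1 : α x = β x) (h2 : α y = β y) : α = β := by
  have : (α : H →* H) = (β : H →* H) :=
    MonoidHom.eq_of_eqOn_dense hgen (by rintro z (rfl | rfl) <;> simpa)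
  ext z
  exact DFunLike.congr_fun this z

theorem closure_mulAut_pair {x y : H} (hgen : Subgroup.closure {x, y} = ⊤) (α : MulAut H) :
    Subgroup.closure {α x, α y} = ⊤ := by
  have := α.toMonoidHom.map_closure {x, y}
  rw [hgen, Set.image_pair, Subgroup.map_top_of_surjective _ α.surjective] at this
  exact this.symm

/-- The orbit map `(i, α) ↦ α • (xᵢ, yᵢ)` into generating pairs. -/
def orbitMap {ι : Type*} (T : ι → H × H) (hgen : ∀ i, Subgroup.closure {(T i).1, (T i).2} = ⊤) :
    ι × MulAut H → {p : H × H // Subgroup.closure {p.1, p.2} = ⊤} :=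
  fun z => ⟨(z.2 (T z.1).1, z.2 (T z.1).2), closure_mulAut_pair (hgen z.1) z.2⟩

theorem orbitMap_injective {ι : Type*} (T : ι → H × H)
    (hgen : ∀ i, Subgroup.closure {(T i).1, (T i).2} = ⊤)
    (hineq : ∀ i j, i ≠ j → ¬ PairEquiv (T i) (T j)) :
    Function.Injective (orbitMap T hgen) := by
  rintro ⟨i, α⟩ ⟨j, β⟩ h
  simp only [orbitMap, Subtype.mk.injEq, Prod.mk.injEq] at h
  obtain rfl : i = j := by
    by_contra hij
    exact hineq i j hij ⟨β⁻¹ * α, by simp [h.1], by simp [h.2]⟩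
  rw [mulAut_eq_of_pair (hgen i) h.1 h.2]

theorem card_mul_card_mulAut_le_phi2 [Finite H] (k : ℕ) (T : Fin k → H × H)
    (hgen : ∀ i, Subgroup.closure {(T i).1, (T i).2} = ⊤)
    (hineq : ∀ i j, i ≠ j → ¬ PairEquiv (T i) (T j)) :
    k * Nat.card (MulAut H) ≤ phi2 H := by
  have := Nat.card_le_card_of_injective _ (orbitMap_injective T hgen hineq)
  rwa [Nat.card_prod, Nat.card_fin] at this

theorem card_mul_card_mulAut_le_phi2_of_closure [Finite H] [Nontrivial H] (k : ℕ)
    (x y : Fin k → H) (h : Subgroup.closure {x, y} = ⊤) :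
    k * Nat.card (MulAut H) ≤ phi2 H := by
  refine card_mul_card_mulAut_le_phi2 k (fun i => (x i, y i)) (fun i => ?_) ?_
  · have := (Pi.evalMonoidHom (fun _ : Fin k => H) i).map_closure {x, y}
    rw [h, Set.image_pair, Subgroup.map_top_of_surjective _ (Function.surjective_eval i)] at this
    exact this.symm
  · rintro i j hij ⟨α, h1, h2⟩
    obtain ⟨z, hz⟩ := exists_ne (1 : H)
    have : α.toMonoidHom.comp (Pi.evalMonoidHom (fun _ : Fin k => H) i) =
        Pi.evalMonoidHom (fun _ : Fin k => H) j :=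
      MonoidHom.eq_of_eqOn_dense h (by rintro w (rfl | rfl) <;> simpa)
    have := DFunLike.congr_fun this (Pi.mulSingle j z)
    simp [hij] at this
    exact hz this.symm

/-- The first `n` terms of `T` are pairwise inequivalent generating pairs. -/
def IsGenFamily (n : ℕ) (T : ℕ → H × H) : Prop :=
  (∀ i < n, Subgroup.closure {(T i).1, (T i).2} = ⊤) ∧ ∀ j < n, ∀ i < j, ¬ PairEquiv (T i) (T j)

theorem IsGenFamily.mono {m n : ℕ} {T : ℕ → H × H} (h : IsGenFamily n T) (hmn : m ≤ n) :
    IsGenFamily m T :=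
  ⟨fun i hi => h.1 i (hi.trans_le hmn), fun j hj => h.2 j (hj.trans_le hmn)⟩

theorem IsGenFamily.ineq {n : ℕ} {T : ℕ → H × H} (h : IsGenFamily n T) {i j : ℕ} (hi : i < n)
    (hj : j < n) (hij : i ≠ j) : ¬ PairEquiv (T i) (T j) := by
  rcases lt_or_gt_of_ne hij with h' | h'
  · exact h.2 j hj i h'
  · exact fun e => h.2 i hi j h' e.symm

theorem IsGenFamily.extend [Finite H] {r k : ℕ} (hrk : r ≤ k)
    (hk : k * Nat.card (MulAut H) ≤ phi2 H) {T : ℕ → H × H} (h : IsGenFamily r T) :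
    ∃ T' : ℕ → H × H, IsGenFamily k T' ∧ ∀ i < r, T' i = T i := by
  induction k, hrk using Nat.le_induction with
  | base => exact ⟨T, h, fun _ _ => rfl⟩
  | succ k hrk ih =>
    have hpos : 0 < Nat.card (MulAut H) := Nat.card_pos
    obtain ⟨T', hT', hag⟩ := ih (by nlinarith)
    have hgen : ∀ i : Fin k, Subgroup.closure {(T' i).1, (T' i).2} = ⊤ := fun i => hT'.1 i i.2
    obtain ⟨⟨p, hp⟩, hnew⟩ : ∃ p, p ∉ Set.range (orbitMap (fun i : Fin k => T' i) hgen) := by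
      by_contra! hcon
      have := Nat.card_le_card_of_surjective _ (fun p => hcon p)
      rw [Nat.card_prod, Nat.card_fin] at this
      have h2 : phi2 H = Nat.card {p : H × H // Subgroup.closure {p.1, p.2} = ⊤} := rfl
      nlinarith
    have hne : ∀ i < k, ¬ PairEquiv (T' i) p := by
      rintro i hi ⟨α, h1, h2⟩
      exact hnew ⟨(⟨i, hi⟩, α), by simp [orbitMap, h1, h2]⟩
    refine ⟨Function.update T' k p, ⟨fun i hi => ?_, fun j hj i hi => ?_⟩, fun i hi => ?_⟩
    · rcases Nat.lt_succ_iff_lt_or_eq.1 hi with hi | rfl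
      · rw [Function.update_of_ne hi.ne]; exact hT'.1 i hi
      · simpa using hp
    · rcases Nat.lt_succ_iff_lt_or_eq.1 hj with hj | rfl
      · rw [Function.update_of_ne hj.ne, Function.update_of_ne (hi.trans hj).ne]
        exact hT'.2 j hj i hi
      · rw [Function.update_of_ne hi.ne, Function.update_self]
        exact hne i hi
    · rw [Function.update_of_ne (by omega), hag i hi]

end Products

section Criterion

variable {H : Type*} [Group H]

/-- The entries of the triple `(x, y, (xy)⁻¹)`. -/
def slot (p : H × H) : Fin 3 → H := ![p.1, p.2, (p.1 * p.2)⁻¹]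

/-- The triple `(x, y, (xy)⁻¹)`. -/
def pairTriple (p : H × H) : H × H × H := (p.1, p.2, (p.1 * p.2)⁻¹)

theorem isGenTriple_pairTriple {p : H × H} (h : Subgroup.closure {p.1, p.2} = ⊤) :
    IsGenTriple (pairTriple p) := by
  refine ⟨by simp [pairTriple], eq_top_iff.2 ?_⟩
  rw [← h]
  exact Subgroup.closure_mono (by intro z; simp [pairTriple]; tauto)

theorem mem_sigmaSet_pairTriple [Finite H] {p : H × H} {z : H}
    (h : z ∈ SigmaSet (pairTriple p)) : ∃ s, ∃ g : H, ∃ a : ℕ, g * z * g⁻¹ = slot p s ^ a := by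
  obtain ⟨g, (h | h) | h⟩ := h
  · obtain ⟨a, ha⟩ := mem_powers_iff_mem_zpowers.2 h
    exact ⟨0, g, a, ha.symm⟩
  · obtain ⟨a, ha⟩ := mem_powers_iff_mem_zpowers.2 h
    exact ⟨1, g, a, ha.symm⟩
  · obtain ⟨a, ha⟩ := mem_powers_iff_mem_zpowers.2 h
    exact ⟨2, g, a, ha.symm⟩

theorem slot_apply {ι : Type*} (x y : ι → H) (s : Fin 3) (i : ι) :
    slot (x, y) s i = slot (x i, y i) s := by
  fin_cases s <;> rfl

theorem IsHyperbolic.of_coord {ι : Type*} [Finite H] [Finite ι] {x y : ι → H} (i : ι)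
    (h : IsHyperbolic (pairTriple (x i, y i))) : IsHyperbolic (pairTriple (x, y)) := by
  have key : ∀ z : ι → H, (orderOf z : ℚ)⁻¹ ≤ (orderOf (z i) : ℚ)⁻¹ := by
    intro z
    have h1 : orderOf (z i) ∣ orderOf z := orderOf_map_dvd (Pi.evalMonoidHom (fun _ => H) i) z
    have h2 := Nat.le_of_dvd (orderOf_pos z) h1
    have h3 := orderOf_pos (z i)
    gcongr
  refine lt_of_le_of_lt ?_ h
  exact add_le_add (add_le_add (key x) (key y)) (key (x * y)⁻¹)

theorem eq_one_of_pow_of_coprime {z : H} {m n : ℕ} (hm : z ^ m = 1) (hn : z ^ n = 1)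
    (h : m.Coprime n) : z = 1 := by
  have := Nat.dvd_gcd (orderOf_dvd_of_pow_eq_one hm) (orderOf_dvd_of_pow_eq_one hn)
  rwa [h.gcd_eq_one, Nat.dvd_one, orderOf_eq_one_iff] at this

theorem pow_eq_one_of_conj {z x g : H} {a n : ℕ} (h : g * z * g⁻¹ = x ^ a) (hx : x ^ n = 1) :
    z ^ n = 1 := by
  have : (g * z * g⁻¹) ^ n = 1 := by rw [h, ← pow_mul, mul_comm, pow_mul, hx, one_pow]
  rw [conj_pow] at this
  simpa using this

theorem separate_slots {k : ℕ} {e : Fin 3 → ℕ} (cop : ∀ c c', c ≠ c' → (e c).Coprime (e c'))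
    (cover : ∀ h : H, ∃ c, h ^ e c = 1) {X Y g g' : Fin k → H} {z : Fin k → H} {a b ℓ : ℕ}
    (hz : z ^ ℓ = 1) {c : Fin 3} (hc : ℓ ∣ e c)
    (hX : g * z * g⁻¹ = X ^ a) (hY : g' * z * g'⁻¹ = Y ^ b)
    (hsep : (∃ j, e c ∣ orderOf (X j) ∧ (orderOf (Y j)).Coprime (e c)) ∨
      ∀ j, (orderOf (X j)).Coprime (e c)) : z = 1 := by
  have hXi : ∀ i, g i * z i * (g i)⁻¹ = X i ^ a := fun i => congrFun hX i
  have hYi : ∀ i, g' i * z i * (g' i)⁻¹ = Y i ^ b := fun i => congrFun hY i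
  have hzi : ∀ i, z i ^ ℓ = 1 := fun i => congrFun hz i
  have hcop : ∀ {n : ℕ}, n.Coprime (e c) → n.Coprime ℓ := fun h => h.coprime_dvd_right hc
  ext i
  rcases hsep with ⟨j, h1, h2⟩ | h
  · have hzj : z j = 1 :=
      eq_one_of_pow_of_coprime (pow_eq_one_of_conj (hYi j) (pow_orderOf_eq_one _)) (hzi j) (hcop h2)
    have hXj : X j ^ a = 1 := by rw [← hXi j, hzj]; simp
    have hea : e c ∣ a := h1.trans (orderOf_dvd_of_pow_eq_one hXj)
    obtain ⟨c', hc'⟩ := cover (X i)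
    by_cases hcc : c' = c
    · subst hcc
      obtain ⟨t, rfl⟩ := hea
      have := hXi i
      rw [pow_mul, hc', one_pow, mul_inv_eq_one, mul_eq_left] at this
      exact this
    · exact eq_one_of_pow_of_coprime (pow_eq_one_of_conj (hXi i) hc') (hzi i) (hcop (cop c' c hcc))
  · exact eq_one_of_pow_of_coprime (pow_eq_one_of_conj (hXi i) (pow_orderOf_eq_one _)) (hzi i)
      (hcop (h i))

/-- The criterion for two families to give a Beauville structure on `Hᵏ`. -/
theorem hasBeauvilleStructure_of_separated [Finite H] [IsSimpleGroup H]
    (hna : ∃ a b : H, a * b ≠ b * a) {k : ℕ} (hk : 0 < k) {e : Fin 3 → ℕ}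
    (cop : ∀ c c', c ≠ c' → (e c).Coprime (e c')) (cover : ∀ h : H, ∃ c, h ^ e c = 1)
    {T₁ T₂ : ℕ → H × H} (h₁ : IsGenFamily k T₁) (h₂ : IsGenFamily k T₂)
    (hyp₁ : IsHyperbolic (pairTriple (T₁ 0))) (hyp₂ : IsHyperbolic (pairTriple (T₂ 0)))
    (hsep : ∀ c s s',
      ((∃ j < k, e c ∣ orderOf (slot (T₁ j) s) ∧ (orderOf (slot (T₂ j) s')).Coprime (e c)) ∨
        ∀ j < k, (orderOf (slot (T₁ j) s)).Coprime (e c)) ∨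
      ((∃ j < k, e c ∣ orderOf (slot (T₂ j) s') ∧ (orderOf (slot (T₁ j) s)).Coprime (e c)) ∨
        ∀ j < k, (orderOf (slot (T₂ j) s')).Coprime (e c))) :
    HasBeauvilleStructure (Fin k → H) := by
  have gen : ∀ T : ℕ → H × H, IsGenFamily k T → Subgroup.closure
      {fun j : Fin k => (T j).1, fun j : Fin k => (T j).2} = ⊤ := fun T hT =>
    closure_pair_pi_eq_top hna _ _ (fun i => hT.1 i i.2)
      (fun i j hij => hT.ineq i.2 j.2 (fun h => hij (Fin.ext h)))
  refine ⟨pairTriple (fun j : Fin k => (T₁ j).1, fun j : Fin k => (T₁ j).2),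
    pairTriple (fun j : Fin k => (T₂ j).1, fun j : Fin k => (T₂ j).2),
    isGenTriple_pairTriple (gen T₁ h₁), IsHyperbolic.of_coord ⟨0, hk⟩ hyp₁,
    isGenTriple_pairTriple (gen T₂ h₂), IsHyperbolic.of_coord ⟨0, hk⟩ hyp₂, ?_⟩
  refine Set.eq_singleton_iff_unique_mem.2 ⟨⟨⟨1, by simp⟩, ⟨1, by simp⟩⟩, ?_⟩
  rintro z ⟨hz1, hz2⟩
  by_contra hne
  obtain ⟨s, g, a, hX⟩ := mem_sigmaSet_pairTriple hz1
  obtain ⟨s', g', b, hY⟩ := mem_sigmaSet_pairTriple hz2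
  obtain ⟨ℓ, hℓ, t, ht⟩ := Nat.exists_prime_and_dvd (mt orderOf_eq_one_iff.1 hne)
  have hpos := orderOf_pos z
  have ht0 : 0 < t := by
    rcases Nat.eq_zero_or_pos t with rfl | h
    · omega
    · exact h
  have hw1 : (z ^ t) ^ ℓ = 1 := by rw [← pow_mul, mul_comm, ← ht, pow_orderOf_eq_one]
  have hw : z ^ t ≠ 1 := by
    intro h
    have := Nat.le_of_dvd ht0 (orderOf_dvd_of_pow_eq_one h)
    have := hℓ.two_le
    nlinarith
  have conj_t : ∀ {u x : Fin k → H} {n : ℕ}, u * z * u⁻¹ = x ^ n →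
      u * z ^ t * u⁻¹ = x ^ (n * t) := fun h => by rw [pow_mul, ← h, conj_pow]
  have hXt := conj_t hX
  have hYt := conj_t hY
  obtain ⟨i, hi⟩ := Function.ne_iff.1 hw
  obtain ⟨c, hc⟩ := cover ((z ^ t) i)
  have hℓc : ℓ ∣ e c := by
    have : Fact ℓ.Prime := ⟨hℓ⟩
    rw [← orderOf_eq_prime (congrFun hw1 i) hi]
    exact orderOf_dvd_of_pow_eq_one hc
  rcases hsep c s s' with h | h
  · refine hw (separate_slots cop cover hw1 hℓc hXt hYt (h.imp ?_ ?_))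
    · rintro ⟨j, hj, h⟩
      exact ⟨⟨j, hj⟩, by rw [slot_apply, slot_apply]; exact h⟩
    · intro h j
      rw [slot_apply]; exact h j j.2
  · refine hw (separate_slots cop cover hw1 hℓc hYt hXt (h.imp ?_ ?_))
    · rintro ⟨j, hj, h⟩
      exact ⟨⟨j, hj⟩, by rw [slot_apply, slot_apply]; exact h⟩
    · intro h j
      rw [slot_apply]; exact h j j.2

/-- In the pattern of classes `d₁, d₂` (with exactness flags `f₁, f₂`), the class `c` in positions
`s, s'` is told apart by one of the first `k` coordinates. -/
def Detects (d₁ d₂ : ℕ → Fin 3 → Fin 3) (f₁ f₂ : ℕ → Fin 3 → Bool) (k : ℕ) (c s s' : Fin 3) :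
    Prop :=
  ∃ j < k, (d₁ j s = c ∧ f₁ j s = true ∧ d₂ j s' ≠ c) ∨ (d₂ j s' = c ∧ f₂ j s' = true ∧ d₁ j s ≠ c)

/-- One of the patterns avoids the class `c` in the first `k` coordinates. -/
def Avoids (d₁ d₂ : ℕ → Fin 3 → Fin 3) (k : ℕ) (c s s' : Fin 3) : Prop :=
  (∀ j < k, d₁ j s ≠ c) ∨ ∀ j < k, d₂ j s' ≠ c

instance (d₁ d₂ : ℕ → Fin 3 → Fin 3) (f₁ f₂ : ℕ → Fin 3 → Bool) (k : ℕ) (c s s' : Fin 3) :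
    Decidable (Detects d₁ d₂ f₁ f₂ k c s s') := by unfold Detects; infer_instance

instance (d₁ d₂ : ℕ → Fin 3 → Fin 3) (k : ℕ) (c s s' : Fin 3) :
    Decidable (Avoids d₁ d₂ k c s s') := by unfold Avoids; infer_instance

/-- The entries of the first `r` triples have orders as prescribed by the pattern `d`, exactly
so where `f` is set. -/
def FollowsPattern (e : Fin 3 → ℕ) (r : ℕ) (T : ℕ → H × H) (d : ℕ → Fin 3 → Fin 3)
    (f : ℕ → Fin 3 → Bool) : Prop :=
  ∀ j < r, ∀ s, slot (T j) s ^ e (d j s) = 1 ∧ (f j s = true → e (d j s) ∣ orderOf (slot (T j) s))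

theorem hasBeauvilleStructure_of_pattern [Finite H] [IsSimpleGroup H]
    (hna : ∃ a b : H, a * b ≠ b * a) {e : Fin 3 → ℕ}
    (cop : ∀ c c', c ≠ c' → (e c).Coprime (e c')) (cover : ∀ h : H, ∃ c, h ^ e c = 1)
    {r : ℕ} (hr : 0 < r) {T₁ T₂ : ℕ → H × H} (h₁ : IsGenFamily r T₁) (h₂ : IsGenFamily r T₂)
    (hyp₁ : IsHyperbolic (pairTriple (T₁ 0))) (hyp₂ : IsHyperbolic (pairTriple (T₂ 0)))
    {d₁ d₂ : ℕ → Fin 3 → Fin 3} {f₁ f₂ : ℕ → Fin 3 → Bool}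
    (hf₁ : FollowsPattern e r T₁ d₁ f₁) (hf₂ : FollowsPattern e r T₂ d₂ f₂) {k₀ : ℕ} (hk₀ : 0 < k₀)
    (hdet : ∀ c s s', Detects d₁ d₂ f₁ f₂ r c s s')
    (hav : ∀ k < r, k₀ ≤ k → ∀ c s s', Detects d₁ d₂ f₁ f₂ k c s s' ∨ Avoids d₁ d₂ k c s s')
    {k : ℕ} (hk : k₀ ≤ k) (hcard : k * Nat.card (MulAut H) ≤ phi2 H) :
    HasBeauvilleStructure (Fin k → H) := by
  have hcopr : ∀ {T : ℕ → H × H} {d f}, FollowsPattern e r T d f → ∀ j < r, ∀ s c, d j s ≠ c →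
      (orderOf (slot (T j) s)).Coprime (e c) := fun h j hj s c hc =>
    (cop _ _ hc).coprime_dvd_left (orderOf_dvd_of_pow_eq_one (h j hj s).1)
  have hfull : ∀ {T : ℕ → H × H} {d f}, FollowsPattern e r T d f → ∀ j < r, ∀ s c, d j s = c →
      f j s = true → e c ∣ orderOf (slot (T j) s) := by
    rintro T d f h j hj s c rfl hc
    exact (h j hj s).2 hc
  rcases lt_or_ge k r with hkr | hrk
  · refine hasBeauvilleStructure_of_separated hna (hk₀.trans_le hk) cop cover (h₁.mono hkr.le)
      (h₂.mono hkr.le) hyp₁ hyp₂ fun c s s' => ?_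
    rcases hav k hkr hk c s s' with ⟨j, hj, h | h⟩ | h | h
    · exact .inl (.inl ⟨j, hj, hfull hf₁ j (hj.trans hkr) s c h.1 h.2.1,
        hcopr hf₂ j (hj.trans hkr) s' c h.2.2⟩)
    · exact .inr (.inl ⟨j, hj, hfull hf₂ j (hj.trans hkr) s' c h.1 h.2.1,
        hcopr hf₁ j (hj.trans hkr) s c h.2.2⟩)
    · exact .inl (.inr fun j hj => hcopr hf₁ j (hj.trans hkr) s c (h j hj))
    · exact .inr (.inr fun j hj => hcopr hf₂ j (hj.trans hkr) s' c (h j hj))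
  · obtain ⟨T₁', h₁', e₁⟩ := h₁.extend hrk hcard
    obtain ⟨T₂', h₂', e₂⟩ := h₂.extend hrk hcard
    refine hasBeauvilleStructure_of_separated hna (hr.trans_le hrk) cop cover h₁' h₂'
      (by rwa [e₁ 0 hr]) (by rwa [e₂ 0 hr]) fun c s s' => ?_
    obtain ⟨j, hj, h | h⟩ := hdet c s s'
    · exact .inl (.inl ⟨j, hj.trans_le hrk, by
        rw [e₁ j hj]; exact hfull hf₁ j hj s c h.1 h.2.1, by
        rw [e₂ j hj]; exact hcopr hf₂ j hj s' c h.2.2⟩)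
    · exact .inr (.inl ⟨j, hj.trans_le hrk, by
        rw [e₂ j hj]; exact hfull hf₂ j hj s' c h.1 h.2.1, by
        rw [e₁ j hj]; exact hcopr hf₁ j hj s c h.2.2⟩)

end Criterion

section Orders

variable {F : Type*} [Field F]

/-- The projection from `SL₂` to `PSL₂`. -/
def toPSL (F : Type*) [Field F] : SL(2, F) →* PSL(2, F) := QuotientGroup.mk' _

theorem toPSL_surjective : Function.Surjective (toPSL F) := QuotientGroup.mk'_surjective _

theorem toPSL_eq_one_iff {B : SL(2, F)} : toPSL F B = 1 ↔ B = 1 ∨ B = -1 := by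
  rw [← MonoidHom.mem_ker, toPSL, QuotientGroup.ker_mk', Matrix.SpecialLinearGroup.mem_center_iff]
  constructor
  · rintro ⟨r, hr, h⟩
    rw [Fintype.card_fin, sq_eq_one_iff] at hr
    rcases hr with rfl | rfl
    · left; ext i j; rw [← h]; simp [Matrix.one_apply, Matrix.diagonal_apply]
    · right; ext i j; rw [← h]; fin_cases i <;> fin_cases j <;> simp
  · rintro (rfl | rfl)
    · exact ⟨1, by simp, by simp⟩
    · exact ⟨-1, by simp, by ext i j; fin_cases i <;> fin_cases j <;> simp⟩

/-- The trace of an element of `SL₂`. -/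
def tr (B : SL(2, F)) : F := B 0 0 + B 1 1

theorem SL2_det (B : SL(2, F)) : B 0 0 * B 1 1 - B 0 1 * B 1 0 = 1 := by
  rw [← Matrix.det_fin_two]; exact B.2

theorem SL2_ext {B C : SL(2, F)} (h00 : B 0 0 = C 0 0) (h01 : B 0 1 = C 0 1) (h10 : B 1 0 = C 1 0)
    (h11 : B 1 1 = C 1 1) : B = C := by
  ext i j; fin_cases i <;> fin_cases j <;> assumption

theorem SL2_mul_apply (B C : SL(2, F)) (i j : Fin 2) :
    (B * C) i j = B i 0 * C 0 j + B i 1 * C 1 j := by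
  rw [Matrix.SpecialLinearGroup.coe_mul, Matrix.mul_apply, Fin.sum_univ_two]

theorem SL2_inv_apply (B : SL(2, F)) :
    (B⁻¹) 0 0 = B 1 1 ∧ (B⁻¹) 0 1 = - B 0 1 ∧ (B⁻¹) 1 0 = - B 1 0 ∧ (B⁻¹) 1 1 = B 0 0 := by
  rw [Matrix.SpecialLinearGroup.coe_inv, Matrix.adjugate_fin_two]
  simp

theorem tr_inv (B : SL(2, F)) : tr B⁻¹ = tr B := by
  obtain ⟨h1, -, -, h2⟩ := SL2_inv_apply B
  rw [tr, tr, h1, h2, add_comm]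

theorem tr_conj (g B : SL(2, F)) : tr (g * B * g⁻¹) = tr B := by
  obtain ⟨h1, h2, h3, h4⟩ := SL2_inv_apply g
  simp only [tr, SL2_mul_apply, h1, h2, h3, h4]
  linear_combination (B 0 0 + B 1 1) * SL2_det g

theorem pow_formula {K : Type*} [Field K] [Algebra F K] {B : SL(2, F)} {ζ : K} (h0 : ζ ≠ 0)
    (h : algebraMap F K (tr B) = ζ + ζ⁻¹) (a : ℕ) (i j : Fin 2) :
    (ζ - ζ⁻¹) * algebraMap F K ((B ^ a) i j) = (ζ ^ a - (ζ⁻¹) ^ a) * algebraMap F K (B i j) -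
      (ζ ^ a * ζ⁻¹ - (ζ⁻¹) ^ a * ζ) * (1 : Matrix (Fin 2) (Fin 2) K) i j := by
  have hd := congrArg (algebraMap F K) (SL2_det B)
  rw [tr] at h
  simp only [map_sub, map_mul, map_one, map_add] at hd h
  have hz : ζ * ζ⁻¹ = 1 := mul_inv_cancel₀ h0
  generalize ζ⁻¹ = ξ at *
  induction a generalizing i j with
  | zero =>
    fin_cases i <;> fin_cases j <;> simp
  | succ a ih =>
    have ih00 := ih 0 0
    have ih01 := ih 0 1
    have ih10 := ih 1 0
    have ih11 := ih 1 1
    rw [pow_succ, SL2_mul_apply, map_add, map_mul, map_mul]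
    simp at ih00 ih01 ih10 ih11
    fin_cases i <;> fin_cases j <;> simp
    · linear_combination algebraMap F K (B 0 0) * ih00 + algebraMap F K (B 1 0) * ih01 +
        (ζ ^ a - ξ ^ a) * (algebraMap F K (B 0 0) * h - hd) + (ζ ^ a - ξ ^ a) * hz
    · linear_combination algebraMap F K (B 0 1) * ih00 + algebraMap F K (B 1 1) * ih01 +
        (ζ ^ a - ξ ^ a) * algebraMap F K (B 0 1) * h
    · linear_combination algebraMap F K (B 0 0) * ih10 + algebraMap F K (B 1 0) * ih11 +
        (ζ ^ a - ξ ^ a) * algebraMap F K (B 1 0) * h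
    · linear_combination algebraMap F K (B 0 1) * ih10 + algebraMap F K (B 1 1) * ih11 +
        (ζ ^ a - ξ ^ a) * (algebraMap F K (B 1 1) * h - hd) + (ζ ^ a - ξ ^ a) * hz

/-- The order of a semisimple element of `PSL₂` is read off from an eigenvalue. -/
theorem toPSL_pow_eq_one_iff {K : Type*} [Field K] [Algebra F K] {B : SL(2, F)} {ζ : K}
    (h0 : ζ ≠ 0) (h1 : ζ ^ 2 ≠ 1) (h : algebraMap F K (tr B) = ζ + ζ⁻¹) (a : ℕ) :
    toPSL F B ^ a = 1 ↔ ζ ^ (2 * a) = 1 := by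
  have hsub : ζ - ζ⁻¹ ≠ 0 := by
    intro h'
    apply h1
    rw [sub_eq_zero] at h'
    rw [sq]
    nth_rw 2 [h']
    exact mul_inv_cancel₀ h0
  have key := pow_formula h0 h a
  have inj := FaithfulSMul.algebraMap_injective F K
  rw [← map_pow, toPSL_eq_one_iff]
  constructor
  · intro hB
    obtain ⟨ε, hB⟩ : ∃ ε : F, ∀ i j, (B ^ a) i j = ε * (1 : Matrix (Fin 2) (Fin 2) F) i j := by
      rcases hB with hB | hB
      · exact ⟨1, fun i j => by rw [hB]; simp⟩
      · exact ⟨-1, fun i j => by rw [hB]; simp⟩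
    by_contra hne
    have hz : ζ ^ a - ζ⁻¹ ^ a ≠ 0 := by
      intro h'
      apply hne
      rw [sub_eq_zero] at h'
      rw [mul_comm, pow_mul, sq]
      nth_rw 2 [h']
      rw [inv_pow]
      exact mul_inv_cancel₀ (pow_ne_zero _ h0)
    have k01 := key 0 1
    have k10 := key 1 0
    have k00 := key 0 0
    have k11 := key 1 1
    rw [hB] at k01 k10 k00 k11
    simp only [Matrix.one_apply, Fin.isValue, zero_ne_one, one_ne_zero,
      if_true, if_false, mul_zero, map_zero, sub_zero] at k01 k10 k00 k11
    have h01 : B 0 1 = 0 := by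
      rcases mul_eq_zero.1 k01.symm with k | k
      · exact absurd k hz
      · exact inj (by rw [k, map_zero])
    have heq : algebraMap F K (B 0 0) = algebraMap F K (B 1 1) :=
      mul_left_cancel₀ hz (by linear_combination k11 - k00)
    have hd := congrArg (algebraMap F K) (SL2_det B)
    rw [tr] at h
    rw [h01] at hd
    simp only [map_sub, map_mul, map_one, map_add, zero_mul, map_zero, sub_zero] at hd h
    have hzz : ζ * ζ⁻¹ = 1 := mul_inv_cancel₀ h0
    apply hsub
    rw [← sq_eq_zero_iff]
    rw [heq] at h hd
    linear_combination (-2 * algebraMap F K (B 1 1) - ζ - ζ⁻¹) * h + 4 * hd - 4 * hzz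
  · intro hz
    rw [mul_comm, pow_mul, sq_eq_one_iff] at hz
    rcases hz with hz | hz
    · left
      ext i j
      apply inj
      apply mul_left_cancel₀ hsub
      rw [key, inv_pow, hz]
      fin_cases i <;> fin_cases j <;> simp
    · right
      ext i j
      apply inj
      apply mul_left_cancel₀ hsub
      rw [key, inv_pow, hz]
      fin_cases i <;> fin_cases j <;> simp
      all_goals ring

theorem pow_formula_of_double_root {B : SL(2, F)} {ε : F} (hε : ε ^ 2 = 1) (h : tr B = ε + ε)
    (a : ℕ) (i j : Fin 2) : (B ^ a) i j = a * ε ^ (a + 1) * B i j -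
      (a - 1) * ε ^ a * (1 : Matrix (Fin 2) (Fin 2) F) i j := by
  have hd := SL2_det B
  rw [tr] at h
  induction a generalizing i j with
  | zero => fin_cases i <;> fin_cases j <;> simp
  | succ a ih =>
    have ih00 := ih 0 0
    have ih01 := ih 0 1
    have ih10 := ih 1 0
    have ih11 := ih 1 1
    rw [pow_succ, SL2_mul_apply]
    simp at ih00 ih01 ih10 ih11
    fin_cases i <;> fin_cases j <;> simp
    · linear_combination B 0 0 * ih00 + B 1 0 * ih01 +
        a * ε ^ (a + 1) * (B 0 0 * h - hd) + (a - 1) * ε ^ a * B 0 0 * hε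
    · linear_combination B 0 1 * ih00 + B 1 1 * ih01 + a * ε ^ (a + 1) * B 0 1 * h +
        (a - 1) * ε ^ a * B 0 1 * hε
    · linear_combination B 0 0 * ih10 + B 1 0 * ih11 + a * ε ^ (a + 1) * B 1 0 * h +
        (a - 1) * ε ^ a * B 1 0 * hε
    · linear_combination B 0 1 * ih10 + B 1 1 * ih11 +
        a * ε ^ (a + 1) * (B 1 1 * h - hd) + (a - 1) * ε ^ a * B 1 1 * hε

theorem toPSL_pow_char_eq_one {p : ℕ} [CharP F p] {B : SL(2, F)} {ε : F}
    (hε : ε ^ 2 = 1) (h : tr B = ε + ε) : toPSL F B ^ p = 1 := by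
  have key := pow_formula_of_double_root hε h p
  rw [← map_pow, toPSL_eq_one_iff]
  have hp : (ε ^ p) ^ 2 = 1 := by rw [← pow_mul, mul_comm, pow_mul, hε, one_pow]
  rcases sq_eq_one_iff.1 hp with hp | hp
  · left; ext i j; rw [key]; simp [hp]
  · right; ext i j; rw [key]; simp [hp]

end Orders

section Exponents

variable {F : Type*} [Field F]

theorem dvd_two_mul_div_gcd (N : ℕ) : N ∣ 2 * (N / Nat.gcd 2 N) := by
  obtain ⟨d, hd⟩ := Nat.gcd_dvd_left 2 N
  refine ⟨d, ?_⟩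
  nth_rw 1 [hd]
  rw [mul_right_comm, Nat.mul_div_cancel' (Nat.gcd_dvd_right 2 N)]

theorem div_gcd_dvd_of_dvd_two_mul {N o : ℕ} (h : N ∣ 2 * o) : N / Nat.gcd 2 N ∣ o := by
  have hpos : 0 < Nat.gcd 2 N := Nat.gcd_pos_of_pos_left _ two_pos
  have hc : (N / Nat.gcd 2 N).Coprime (2 / Nat.gcd 2 N) := (Nat.coprime_div_gcd_div_gcd hpos).symm
  refine hc.dvd_of_dvd_mul_left ?_
  rw [← Nat.mul_dvd_mul_iff_left hpos, ← mul_assoc, Nat.mul_div_cancel' (Nat.gcd_dvd_right 2 N),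
    Nat.mul_div_cancel' (Nat.gcd_dvd_left 2 N)]
  exact h

theorem toPSL_pow_div_gcd {K : Type*} [Field K] [Algebra F K] {B : SL(2, F)} {ζ : K}
    (h0 : ζ ≠ 0) (h1 : ζ ^ 2 ≠ 1) (h : algebraMap F K (tr B) = ζ + ζ⁻¹) {N : ℕ} (hN : ζ ^ N = 1) :
    toPSL F B ^ (N / Nat.gcd 2 N) = 1 := by
  rw [toPSL_pow_eq_one_iff h0 h1 h]
  obtain ⟨c, hc⟩ := dvd_two_mul_div_gcd N
  rw [hc, pow_mul, hN, one_pow]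

theorem div_gcd_dvd_orderOf_toPSL {K : Type*} [Field K] [Algebra F K] {B : SL(2, F)} {ζ : K}
    (h0 : ζ ≠ 0) (h1 : ζ ^ 2 ≠ 1) (h : algebraMap F K (tr B) = ζ + ζ⁻¹) :
    orderOf ζ / Nat.gcd 2 (orderOf ζ) ∣ orderOf (toPSL F B) := by
  apply div_gcd_dvd_of_dvd_two_mul
  rw [orderOf_dvd_iff_pow_eq_one, ← toPSL_pow_eq_one_iff h0 h1 h, pow_orderOf_eq_one]

/-- The exponents of unipotent, split and nonsplit elements of `PSL₂(q)`. -/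
def pslExp (p q : ℕ) : Fin 3 → ℕ := ![p, (q - 1) / Nat.gcd 2 (q - 1), (q + 1) / Nat.gcd 2 (q + 1)]

theorem pslExp_coprime {p f : ℕ} (hp : p.Prime) (hf : f ≠ 0) (c c' : Fin 3) (h : c ≠ c') :
    (pslExp p (p ^ f) c).Coprime (pslExp p (p ^ f) c') := by
  set q := p ^ f with hq
  have hq2 : 2 ≤ q := hp.two_le.trans (Nat.le_self_pow hf p)
  have hpq : p ∣ q := dvd_pow_self p hf
  have hm : (q - 1) / Nat.gcd 2 (q - 1) ∣ q - 1 := Nat.div_dvd_of_dvd (Nat.gcd_dvd_right _ _)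
  have hn : (q + 1) / Nat.gcd 2 (q + 1) ∣ q + 1 := Nat.div_dvd_of_dvd (Nat.gcd_dvd_right _ _)
  have pm : p.Coprime ((q - 1) / Nat.gcd 2 (q - 1)) := by
    refine Nat.Coprime.coprime_dvd_right hm (Nat.Coprime.coprime_dvd_left hpq ?_)
    rw [Nat.coprime_comm]
    have := Nat.coprime_self_add_right (m := q - 1) (n := 1)
    rw [Nat.sub_add_cancel (by omega)] at this
    exact this.2 (Nat.coprime_one_right _)
  have pn : p.Coprime ((q + 1) / Nat.gcd 2 (q + 1)) :=
    Nat.Coprime.coprime_dvd_right hn (Nat.Coprime.coprime_dvd_left hpq (by simp))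
  have mn : ((q - 1) / Nat.gcd 2 (q - 1)).Coprime ((q + 1) / Nat.gcd 2 (q + 1)) := by
    rw [Nat.coprime_iff_gcd_eq_one, ← Nat.dvd_one]
    rcases Nat.even_or_odd' q with ⟨t, ht | ht⟩
    · have e1 := (Nat.dvd_sub ((Nat.gcd_dvd_right _ _).trans hn) ((Nat.gcd_dvd_left _ _).trans hm))
      rw [show q + 1 - (q - 1) = 2 by omega, Nat.dvd_prime Nat.prime_two] at e1
      rcases e1 with e1 | e1
      · exact e1.dvd
      · exfalso
        have : 2 ∣ q + 1 := e1 ▸ ((Nat.gcd_dvd_right _ _).trans hn)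
        omega
    · have a1 : Nat.gcd 2 (q - 1) = 2 := Nat.gcd_eq_left (by omega)
      have a2 : Nat.gcd 2 (q + 1) = 2 := Nat.gcd_eq_left (by omega)
      rw [a1, a2, show (q - 1) / 2 = t by omega, show (q + 1) / 2 = t + 1 by omega]
      simp
  fin_cases c <;> fin_cases c' <;> simp [pslExp] at h ⊢
  exacts [pm, pn, pm.symm, mn, pn.symm, mn.symm]

theorem exists_pslExp_pow_eq_one [Fintype F] (K : Type*) [Field K] [Algebra F K] [IsAlgClosed K]
    {p : ℕ} [Fact p.Prime] [CharP F p] (h : PSL(2, F)) :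
    ∃ c, h ^ pslExp p (Fintype.card F) c = 1 := by
  obtain ⟨B, rfl⟩ := toPSL_surjective h
  set q := Fintype.card F
  have : CharP K p := charP_of_injective_algebraMap (FaithfulSMul.algebraMap_injective F K) p
  obtain ⟨ζ, hζ⟩ : ∃ ζ : K, ζ * ζ - algebraMap F K (tr B) * ζ + 1 = 0 := by
    have := IsAlgClosed.exists_root (Polynomial.X ^ 2 - Polynomial.C (algebraMap F K (tr B)) *
      Polynomial.X + 1) (by
        have : (Polynomial.X ^ 2 - Polynomial.C (algebraMap F K (tr B)) *
          Polynomial.X + 1).degree = 2 := by compute_degree!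
        rw [this]; decide)
    obtain ⟨ζ, h⟩ := this
    refine ⟨ζ, ?_⟩
    simpa [Polynomial.IsRoot, sq] using h
  have h0 : ζ ≠ 0 := by rintro rfl; simp at hζ
  have ht : algebraMap F K (tr B) = ζ + ζ⁻¹ := by
    field_simp
    linear_combination -hζ
  by_cases h1 : ζ ^ 2 = 1
  · refine ⟨0, ?_⟩
    have hinj := FaithfulSMul.algebraMap_injective F K
    rcases sq_eq_one_iff.1 h1 with rfl | rfl
    · exact toPSL_pow_char_eq_one (ε := 1) (by simp) (hinj (by rw [ht]; simp))
    · exact toPSL_pow_char_eq_one (ε := -1) (by simp) (hinj (by rw [ht, map_add, map_neg, map_one, inv_neg, inv_one]))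
  · have hq : (ζ ^ q) + (ζ ^ q)⁻¹ = ζ + ζ⁻¹ := by
      obtain ⟨f, -, hf⟩ := FiniteField.card F p
      rw [← ht, ← FiniteField.pow_card (tr B), map_pow, ht, ← inv_pow]
      change ζ ^ Fintype.card F + _ = _
      rw [show q = Fintype.card F from rfl, hf, add_pow_char_pow]
    have hprod : (ζ ^ q - ζ) * (ζ ^ q * ζ - 1) = 0 := by
      have h0' : ζ ^ q ≠ 0 := pow_ne_zero _ h0
      field_simp at hq
      linear_combination hq
    have hqpos : 0 < q := Fintype.card_pos
    rcases mul_eq_zero.1 hprod with h | h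
    · refine ⟨1, toPSL_pow_div_gcd h0 h1 ht ?_⟩
      apply mul_right_cancel₀ h0
      rw [← pow_succ, Nat.sub_add_cancel hqpos]
      linear_combination h
    · refine ⟨2, toPSL_pow_div_gcd h0 h1 ht ?_⟩
      rw [pow_succ]; linear_combination h

theorem pslExp_cover [Fintype F] {p : ℕ} [Fact p.Prime] [CharP F p] (h : PSL(2, F)) :
    ∃ c, h ^ pslExp p (Fintype.card F) c = 1 :=
  exists_pslExp_pow_eq_one (AlgebraicClosure F) h

end Exponents

section AlternatingFive

theorem alternatingGroup_five_pow (g : alternatingGroup (Fin 5)) :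
    g ^ 2 = 1 ∨ g ^ 3 = 1 ∨ g ^ 5 = 1 := by
  revert g
  decide +kernel

theorem card_alternatingGroup_five : Nat.card (alternatingGroup (Fin 5)) = 60 := by
  rw [nat_card_alternatingGroup]; simp [Nat.factorial]

instance : IsSimpleGroup (alternatingGroup (Fin 5)) :=
  alternatingGroup.isSimpleGroup (by simp)

theorem eq_top_of_dvd_card {G : Type*} [Group G] [Finite G] [IsSimpleGroup G]
    (hG : Nat.card G = 60) (K : Subgroup G) {a b c : G} (ha : a ∈ K) (hb : b ∈ K) (hc : c ∈ K)
    (ha2 : orderOf a = 2) (hb3 : orderOf b = 3) (hc5 : orderOf c = 5) : K = ⊤ := by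
  have d2 : 2 ∣ Nat.card K := ha2 ▸ Subgroup.orderOf_dvd_natCard K ha
  have d3 : 3 ∣ Nat.card K := hb3 ▸ Subgroup.orderOf_dvd_natCard K hb
  have d5 : 5 ∣ Nat.card K := hc5 ▸ Subgroup.orderOf_dvd_natCard K hc
  have hi := K.card_mul_index
  rw [hG] at hi
  obtain ⟨t, ht⟩ : 30 ∣ Nat.card K := by omega
  rw [ht] at hi
  have : t * K.index = 2 := by nlinarith
  have hd : K.index ∣ 2 := ⟨t, by rw [mul_comm, this]⟩
  rcases (Nat.dvd_prime Nat.prime_two).1 hd with h | h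
  · exact Subgroup.index_eq_one.1 h
  · rcases (Subgroup.normal_of_index_eq_two h).eq_bot_or_eq_top with h' | h'
    · rw [h', Subgroup.card_bot] at ht; omega
    · exact h'

theorem not_hasBeauvilleStructure_of_card_sixty {G : Type*} [Group G] [Finite G]
    (hG : Nat.card G = 60) (hpow : ∀ g : G, g ^ 2 = 1 ∨ g ^ 3 = 1 ∨ g ^ 5 = 1) :
    ¬ HasBeauvilleStructure G := by
  have hord : ∀ g : G, orderOf g = 5 ∨ (3 : ℚ)⁻¹ ≤ (orderOf g : ℚ)⁻¹ := by
    intro g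
    have hpos := orderOf_pos g
    have : orderOf g ≤ 3 → (3 : ℚ)⁻¹ ≤ (orderOf g : ℚ)⁻¹ := fun h => by gcongr; exact_mod_cast h
    rcases hpow g with h | h | h
    · exact .inr (this ((Nat.le_of_dvd (by simp) (orderOf_dvd_of_pow_eq_one h)).trans (by simp)))
    · exact .inr (this ((Nat.le_of_dvd (by simp) (orderOf_dvd_of_pow_eq_one h)).trans (by simp)))
    · rcases (Nat.dvd_prime Nat.prime_five).1 (orderOf_dvd_of_pow_eq_one h) with h | h
      · exact .inr (this (by omega))
      · exact .inl h
  have hfive : ∀ T : G × G × G, IsHyperbolic T →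
      ∃ x : G, orderOf x = 5 ∧ (Subgroup.zpowers x : Set G) ⊆ SigmaSet T := by
    rintro ⟨a, b, c⟩ hT
    rcases hord a with h | ha
    · exact ⟨a, h, fun z hz => ⟨1, by simpa using .inl (.inl hz)⟩⟩
    rcases hord b with h | hb
    · exact ⟨b, h, fun z hz => ⟨1, by simpa using .inl (.inr hz)⟩⟩
    rcases hord c with h | hc
    · exact ⟨c, h, fun z hz => ⟨1, by simpa using .inr hz⟩⟩
    · exfalso
      simp only [IsHyperbolic] at hT
      linarith
  have hconj : ∀ (T : G × G × G) (g z : G), z ∈ SigmaSet T → g * z * g⁻¹ ∈ SigmaSet T := by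
    rintro T g z ⟨u, hu⟩
    refine ⟨u * g⁻¹, ?_⟩
    convert hu using 1
    group
  rintro ⟨T₁, T₂, -, h₁, -, h₂, hsig⟩
  obtain ⟨x, hx, hxT⟩ := hfive T₁ h₁
  obtain ⟨y, hy, hyT⟩ := hfive T₂ h₂
  have : Fact (Nat.Prime 5) := ⟨Nat.prime_five⟩
  have h60 : 5 ^ (Nat.card G).factorization 5 = 5 := by
    rw [hG, show 60 = 5 ^ 1 * 12 by norm_num, Nat.factorization_mul (by norm_num) (by norm_num),
      Nat.factorization_pow, Finsupp.add_apply, Finsupp.smul_apply,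
      Nat.Prime.factorization_self Nat.prime_five,
      Nat.factorization_eq_zero_of_not_dvd (by norm_num : ¬ 5 ∣ 12)]
    norm_num
  obtain ⟨g, hg⟩ := MulAction.exists_smul_eq G
    (Sylow.ofCard (p := 5) (Subgroup.zpowers x) (by rw [Nat.card_zpowers, hx, h60]))
    (Sylow.ofCard (p := 5) (Subgroup.zpowers y) (by rw [Nat.card_zpowers, hy, h60]))
  have hmem : g * x * g⁻¹ ∈ Subgroup.zpowers y := by
    have h := congrArg (fun P : Sylow 5 G => (P : Subgroup G)) hg
    simp only [Sylow.coe_subgroup_smul, Sylow.coe_ofCard] at h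
    rw [← h]
    exact ⟨x, Subgroup.mem_zpowers x, rfl⟩
  have : g * x * g⁻¹ ∈ SigmaSet T₁ ∩ SigmaSet T₂ :=
    ⟨hconj _ _ _ (hxT (Subgroup.mem_zpowers x)), hyT hmem⟩
  rw [hsig, Set.mem_singleton_iff, mul_inv_eq_one, mul_eq_left] at this
  rw [this, orderOf_one] at hx
  omega

theorem not_hasBeauvilleStructure_of_mulEquiv {G : Type*} [Group G]
    (e : G ≃* alternatingGroup (Fin 5)) : ¬ HasBeauvilleStructure G := by
  have : Finite G := Finite.of_equiv _ e.symm.toEquiv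
  refine not_hasBeauvilleStructure_of_card_sixty
    (by rw [Nat.card_congr e.toEquiv, card_alternatingGroup_five]) fun g => ?_
  have := alternatingGroup_five_pow (e g)
  simpa only [← map_pow, EmbeddingLike.map_eq_one_iff] using this

theorem HasBeauvilleStructure.exists_pair {G : Type*} [Group G] (h : HasBeauvilleStructure G) :
    ∃ x y : G, Subgroup.closure {x, y} = ⊤ := by
  obtain ⟨⟨a, b, c⟩, -, ⟨h1, h2⟩, -⟩ := h
  refine ⟨a, b, eq_top_iff.2 ?_⟩
  rw [← h2, Subgroup.closure_le]
  have ha : a ∈ Subgroup.closure {a, b} := Subgroup.subset_closure (by simp)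
  have hb : b ∈ Subgroup.closure {a, b} := Subgroup.subset_closure (by simp)
  rintro z (rfl | rfl | rfl)
  · exact ha
  · exact hb
  · have : z = (a * b)⁻¹ := (inv_eq_of_mul_eq_one_right h1).symm
    rw [this]
    exact Subgroup.inv_mem _ (Subgroup.mul_mem _ ha hb)

end AlternatingFive

section Words

variable {H : Type*} [Group H]

/-- The value of a positive word at a pair; `true` stands for the first entry. -/
def evalWord (p : H × H) (l : List Bool) : H := (l.map fun c => cond c p.1 p.2).prod

theorem evalWord_mem (p : H × H) (l : List Bool) :
    evalWord p l ∈ Subgroup.closure {p.1, p.2} := by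
  refine Subgroup.list_prod_mem _ fun z hz => ?_
  obtain ⟨c, -, rfl⟩ := List.mem_map.1 hz
  cases c
  · exact Subgroup.subset_closure (by simp)
  · exact Subgroup.subset_closure (by simp)

theorem map_evalWord {H' : Type*} [Group H'] (f : H →* H') (p : H × H) (l : List Bool) :
    f (evalWord p l) = evalWord (f p.1, f p.2) l := by
  rw [evalWord, map_list_prod, List.map_map, evalWord]
  congr 2
  ext c
  cases c <;> rfl

theorem not_pairEquiv_of_word {p q : H × H} (l : List Bool)
    (h : ¬ (evalWord p l = 1 ↔ evalWord q l = 1)) : ¬ PairEquiv p q := by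
  rintro ⟨α, h1, h2⟩
  apply h
  have := map_evalWord α.toMonoidHom p l
  rw [← (show (α.toMonoidHom p.1, α.toMonoidHom p.2) = q from Prod.ext h1 h2), ← this]
  exact (map_eq_one_iff α.toMonoidHom α.injective).symm

theorem isHyperbolic_of_orderOf {p : H × H} {a b c : ℕ} (ha : orderOf (slot p 0) = a)
    (hb : orderOf (slot p 1) = b) (hc : orderOf (slot p 2) = c)
    (h : (a : ℚ)⁻¹ + (b : ℚ)⁻¹ + (c : ℚ)⁻¹ < 1) : IsHyperbolic (pairTriple p) := by
  subst ha hb hc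
  exact h

theorem followsPattern_of_orderOf {e : Fin 3 → ℕ} {r : ℕ} {T : ℕ → H × H} {d : ℕ → Fin 3 → Fin 3}
    (h : ∀ j < r, ∀ s, orderOf (slot (T j) s) = e (d j s)) :
    FollowsPattern e r T d fun _ _ => true := fun j hj s =>
  ⟨by rw [← h j hj s, pow_orderOf_eq_one], fun _ => by rw [h j hj s]⟩

theorem hasBeauvilleStructure_of_mulEquiv {G : Type*} [Group G] (φ : G ≃* H)
    (h : HasBeauvilleStructure G) : HasBeauvilleStructure H := by
  let m : G × G × G → H × H × H := fun T => (φ T.1, φ T.2.1, φ T.2.2)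
  have hgen : ∀ T, IsGenTriple T → IsGenTriple (m T) := by
    rintro ⟨a, b, c⟩ ⟨h1, h2⟩
    refine ⟨?_, ?_⟩
    · simp only at h1
      simp only [m, ← map_mul, h1, map_one]
    · have := φ.toMonoidHom.map_closure {a, b, c}
      rw [h2, Subgroup.map_top_of_surjective _ φ.surjective, Set.image_insert_eq,
        Set.image_pair] at this
      exact this.symm
  have hhyp : ∀ T, IsHyperbolic T → IsHyperbolic (m T) := by
    intro T hT
    simpa only [IsHyperbolic, m, MulEquiv.orderOf_eq] using hT
  have hsig : ∀ T z, z ∈ SigmaSet (m T) → φ.symm z ∈ SigmaSet T := by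
    rintro T z ⟨g, hg⟩
    have key : ∀ x, g * z * g⁻¹ ∈ Subgroup.zpowers (φ x) →
        φ.symm g * φ.symm z * (φ.symm g)⁻¹ ∈ Subgroup.zpowers x := by
      rintro x ⟨n, hn⟩
      refine ⟨n, ?_⟩
      apply φ.injective
      simpa using hn
    exact ⟨φ.symm g, hg.imp (Or.imp (key _) (key _)) (key _)⟩
  obtain ⟨T₁, T₂, g₁, h₁, g₂, h₂, hs⟩ := h
  refine ⟨m T₁, m T₂, hgen _ g₁, hhyp _ h₁, hgen _ g₂, hhyp _ h₂, ?_⟩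
  refine Set.eq_singleton_iff_unique_mem.2 ⟨⟨⟨1, by simp⟩, ⟨1, by simp⟩⟩, ?_⟩
  rintro z ⟨hz1, hz2⟩
  have : φ.symm z ∈ SigmaSet T₁ ∩ SigmaSet T₂ := ⟨hsig _ _ hz1, hsig _ _ hz2⟩
  rw [hs, Set.mem_singleton_iff] at this
  simpa using this

theorem phi2_congr {G : Type*} [Group G] (φ : G ≃* H) : phi2 G = phi2 H := by
  refine Nat.card_congr (Equiv.subtypeEquiv (Equiv.prodCongr φ.toEquiv φ.toEquiv) ?_)
  rintro ⟨a, b⟩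
  have := φ.toMonoidHom.map_closure {a, b}
  rw [Set.image_pair] at this
  change _ ↔ Subgroup.closure {φ.toMonoidHom a, φ.toMonoidHom b} = ⊤
  rw [← this]
  constructor
  · intro h
    simp only at h
    rw [h, Subgroup.map_top_of_surjective _ φ.surjective]
  · intro h
    rw [← Subgroup.comap_map_eq_self_of_injective (f := φ.toMonoidHom) φ.injective
      (Subgroup.closure {a, b}), h, Subgroup.comap_top]

/-- The powers of `H` allowed by the counting bound have Beauville structures, from `k₀` on. -/
def HasBeauvillePowers (H : Type*) [Group H] (k₀ : ℕ) : Prop :=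
  ∀ k, k₀ ≤ k → k * Nat.card (MulAut H) ≤ phi2 H → HasBeauvilleStructure (Fin k → H)

theorem HasBeauvillePowers.congr {G : Type*} [Group G] (φ : G ≃* H) {k₀ : ℕ}
    (h : HasBeauvillePowers G k₀) : HasBeauvillePowers H k₀ := by
  intro k hk hc
  refine hasBeauvilleStructure_of_mulEquiv (MulEquiv.piCongrRight fun _ => φ) (h k hk ?_)
  rwa [phi2_congr φ, Nat.card_congr (MulAut.congr φ).toEquiv]

end Words

section AlternatingFivePowers

/-- An even permutation as an element of the alternating group. -/
def toAlt (g : Equiv.Perm (Fin 5)) (h : Equiv.Perm.sign g = 1) : alternatingGroup (Fin 5) :=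
  ⟨g, Equiv.Perm.mem_alternatingGroup.2 h⟩

/-- First family of generating pairs of `A₅`. -/
def altPairs₁ : ℕ → alternatingGroup (Fin 5) × alternatingGroup (Fin 5)
  | 0 => (toAlt (c[0, 1, 2, 3, 4]) (by decide +kernel), toAlt (c[0, 1, 4, 3, 2]) (by decide +kernel))
  | 1 => (toAlt (c[0, 1, 2, 3, 4]) (by decide +kernel), toAlt (c[0, 2, 4, 3, 1]) (by decide +kernel))
  | _ => (toAlt (c[2, 3, 4]) (by decide +kernel), toAlt (c[0, 1, 2]) (by decide +kernel))

/-- Second family of generating pairs of `A₅`. -/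
def altPairs₂ : ℕ → alternatingGroup (Fin 5) × alternatingGroup (Fin 5)
  | 0 => (toAlt (c[0, 1, 2, 3, 4]) (by decide +kernel), toAlt (c[0, 1, 2, 4, 3]) (by decide +kernel))
  | 1 => (toAlt (c[1, 2] * c[3, 4]) (by decide +kernel), toAlt (c[0, 1, 3]) (by decide +kernel))
  | _ => (toAlt (c[0, 1, 2, 3, 4]) (by decide +kernel), toAlt (c[1, 3] * c[2, 4]) (by decide +kernel))

/-- The orders of the entries of `altPairs₁`, as indices into `![2, 3, 5]`. -/
def altPattern₁ : ℕ → Fin 3 → Fin 3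
  | 0 => ![2, 2, 1]
  | 1 => ![2, 2, 1]
  | _ => ![1, 1, 2]

/-- The orders of the entries of `altPairs₂`, as indices into `![2, 3, 5]`. -/
def altPattern₂ : ℕ → Fin 3 → Fin 3
  | 0 => ![2, 2, 0]
  | 1 => ![0, 1, 2]
  | _ => ![2, 0, 2]

theorem closure_eq_top_of_words {G : Type*} [Group G] [Finite G] [IsSimpleGroup G]
    (hG : Nat.card G = 60) {p : G × G} (l₂ l₃ l₅ : List Bool)
    (h : (evalWord p l₂ ^ 2 = 1 ∧ evalWord p l₂ ≠ 1) ∧ (evalWord p l₃ ^ 3 = 1 ∧ evalWord p l₃ ≠ 1) ∧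
      (evalWord p l₅ ^ 5 = 1 ∧ evalWord p l₅ ≠ 1)) : Subgroup.closure {p.1, p.2} = ⊤ := by
  have : Fact (Nat.Prime 5) := ⟨Nat.prime_five⟩
  exact eq_top_of_dvd_card hG _ (evalWord_mem p l₂) (evalWord_mem p l₃) (evalWord_mem p l₅)
    (orderOf_eq_prime h.1.1 h.1.2) (orderOf_eq_prime h.2.1.1 h.2.1.2)
    (orderOf_eq_prime h.2.2.1 h.2.2.2)

theorem altPairs₁_isGenFamily : IsGenFamily 3 altPairs₁ := by
  refine ⟨fun i hi => ?_, fun j hj i hi => ?_⟩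
  · interval_cases i
    · exact closure_eq_top_of_words card_alternatingGroup_five [true, true, false, false]
        [true, false] [true] (by decide +kernel)
    · exact closure_eq_top_of_words card_alternatingGroup_five [true, true, false]
        [true, false] [true] (by decide +kernel)
    · exact closure_eq_top_of_words card_alternatingGroup_five [true, true, false, true, false]
        [true] [true, false] (by decide +kernel)
  · interval_cases j <;> interval_cases i
    · exact not_pairEquiv_of_word [true, true, false, true, true, false] (by decide +kernel)
    · exact not_pairEquiv_of_word [true, true, true] (by decide +kernel)
    · exact not_pairEquiv_of_word [true, true, true] (by decide +kernel)

theorem altPairs₂_isGenFamily : IsGenFamily 3 altPairs₂ := by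
  refine ⟨fun i hi => ?_, fun j hj i hi => ?_⟩
  · interval_cases i
    · exact closure_eq_top_of_words card_alternatingGroup_five [true, false]
        [true, true, true, false] [true] (by decide +kernel)
    · exact closure_eq_top_of_words card_alternatingGroup_five [true] [false] [true, false]
        (by decide +kernel)
    · exact closure_eq_top_of_words card_alternatingGroup_five [false] [true, true, false] [true]
        (by decide +kernel)
  · interval_cases j <;> interval_cases i
    · exact not_pairEquiv_of_word [true, true] (by decide +kernel)
    · exact not_pairEquiv_of_word [false, false] (by decide +kernel)
    · exact not_pairEquiv_of_word [true, true] (by decide +kernel)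

theorem hasBeauvillePowers_alternatingGroup_five :
    HasBeauvillePowers (alternatingGroup (Fin 5)) 2 := by
  have o₁ : ∀ j < 3, ∀ s, orderOf (slot (altPairs₁ j) s) = ![2, 3, 5] (altPattern₁ j s) := by
    have : ∀ j < 3, ∀ s, 0 < ![2, 3, 5] (altPattern₁ j s) ∧
        slot (altPairs₁ j) s ^ ![2, 3, 5] (altPattern₁ j s) = 1 ∧
        ∀ m < ![2, 3, 5] (altPattern₁ j s), 0 < m → slot (altPairs₁ j) s ^ m ≠ 1 := by
      decide +kernel
    exact fun j hj s => (orderOf_eq_iff (this j hj s).1).2 (this j hj s).2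
  have o₂ : ∀ j < 3, ∀ s, orderOf (slot (altPairs₂ j) s) = ![2, 3, 5] (altPattern₂ j s) := by
    have : ∀ j < 3, ∀ s, 0 < ![2, 3, 5] (altPattern₂ j s) ∧
        slot (altPairs₂ j) s ^ ![2, 3, 5] (altPattern₂ j s) = 1 ∧
        ∀ m < ![2, 3, 5] (altPattern₂ j s), 0 < m → slot (altPairs₂ j) s ^ m ≠ 1 := by
      decide +kernel
    exact fun j hj s => (orderOf_eq_iff (this j hj s).1).2 (this j hj s).2
  intro k hk hc
  refine hasBeauvilleStructure_of_pattern ⟨(altPairs₁ 0).1, (altPairs₁ 0).2, by decide +kernel⟩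
    (e := ![2, 3, 5]) (by decide) (fun h => ?_) (r := 3) (by norm_num) altPairs₁_isGenFamily
    altPairs₂_isGenFamily
    (isHyperbolic_of_orderOf (o₁ 0 (by norm_num) 0) (o₁ 0 (by norm_num) 1) (o₁ 0 (by norm_num) 2)
      (show ((5 : ℕ) : ℚ)⁻¹ + ((5 : ℕ) : ℚ)⁻¹ + ((3 : ℕ) : ℚ)⁻¹ < 1 by norm_num))
    (isHyperbolic_of_orderOf (o₂ 0 (by norm_num) 0) (o₂ 0 (by norm_num) 1) (o₂ 0 (by norm_num) 2)
      (show ((5 : ℕ) : ℚ)⁻¹ + ((5 : ℕ) : ℚ)⁻¹ + ((2 : ℕ) : ℚ)⁻¹ < 1 by norm_num))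
    (followsPattern_of_orderOf o₁) (followsPattern_of_orderOf o₂) (k₀ := 2) (by norm_num)
    (by decide +kernel) (by decide +kernel) hk hc
  rcases alternatingGroup_five_pow h with h | h | h
  · exact ⟨0, h⟩
  · exact ⟨1, h⟩
  · exact ⟨2, h⟩

end AlternatingFivePowers

section Isomorphisms

theorem nonempty_PSL_mulEquiv {F F' : Type*} [Field F] [Field F'] (f : F ≃+* F') :
    Nonempty (PSL(2, F) ≃* PSL(2, F')) := by
  let e : SL(2, F) ≃* SL(2, F') := MulEquiv.ofBijective
    (Matrix.SpecialLinearGroup.map (f : F →+* F')) ⟨fun A B h => by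
      ext i j
      have := congrArg (fun C : SL(2, F') => C i j) h
      simpa using this, fun B => ⟨Matrix.SpecialLinearGroup.map (f.symm : F' →+* F) B, by
      ext i j; simp⟩⟩
  refine ⟨QuotientGroup.congr _ _ e ?_⟩
  ext B
  obtain ⟨A, rfl⟩ := e.surjective B
  change e A ∈ Subgroup.map (e : SL(2, F) →* SL(2, F')) _ ↔ _
  refine (Subgroup.mem_map_iff_mem (f := (e : SL(2, F) →* SL(2, F'))) e.injective).trans ?_
  rw [Subgroup.mem_center_iff, Subgroup.mem_center_iff, ← e.forall_congr_right]
  exact forall_congr' fun B => by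
    change _ ↔ e B * e A = e A * e B
    rw [← map_mul, ← map_mul, e.injective.eq_iff]

theorem nonempty_PSL_mulEquiv_of_card {F F' : Type*} [Field F] [Field F'] [Fintype F] [Fintype F']
    (h : Fintype.card F = Fintype.card F') : Nonempty (PSL(2, F) ≃* PSL(2, F')) :=
  nonempty_PSL_mulEquiv (FiniteField.ringEquivOfCardEq h)

/-- A simple group with elements of orders 2, 3 and 5 and a proper subgroup of index at most 5
is isomorphic to the alternating group on 5 letters. -/
theorem nonempty_mulEquiv_alternatingGroup_five {G ι : Type*} [Group G] [IsSimpleGroup G]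
    [Fintype ι] (hι : Fintype.card ι ≤ 5) {K : Subgroup G} (hK : K ≠ ⊤) (r : ι → G)
    (hr : ∀ g, ∃ i, (r i)⁻¹ * g ∈ K) {a b c : G} (ha : orderOf a = 2) (hb : orderOf b = 3)
    (hc : orderOf c = 5) : Nonempty (G ≃* alternatingGroup (Fin 5)) := by
  classical
  have hsurj : Function.Surjective (fun i => (r i : G ⧸ K)) := by
    intro x
    obtain ⟨g, rfl⟩ := QuotientGroup.mk_surjective x
    obtain ⟨i, hi⟩ := hr g
    exact ⟨i, QuotientGroup.eq.2 hi⟩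
  have : Finite (G ⧸ K) := Finite.of_surjective _ hsurj
  have hle : Nat.card (G ⧸ K) ≤ 5 := (Nat.card_le_card_of_surjective _ hsurj).trans
    (by rwa [Nat.card_eq_fintype_card])
  let f := MulAction.toPermHom G (G ⧸ K)
  have hf : Function.Injective f := by
    rw [← MonoidHom.ker_eq_bot_iff]
    refine (IsSimpleGroup.eq_bot_or_eq_top_of_normal _ inferInstance).resolve_right fun h => hK ?_
    rw [eq_top_iff]
    intro g _
    have hg : g ∈ f.ker := h ▸ Subgroup.mem_top g
    have := congrArg (fun σ => σ ((1 : G) : G ⧸ K)) (MonoidHom.mem_ker.1 hg)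
    have h2 : ((g * 1 : G) : G ⧸ K) = ((1 : G) : G ⧸ K) := this
    rw [mul_one, eq_comm, QuotientGroup.eq] at h2
    simpa using h2
  have hG : Finite G := Finite.of_injective f hf
  have hdvd : Nat.card G ∣ (Nat.card (G ⧸ K)).factorial := by
    rw [← Nat.card_perm]
    exact Subgroup.card_dvd_of_injective f hf
  have h5 : Nat.card (G ⧸ K) = 5 := by
    have h := (hc ▸ orderOf_dvd_natCard c).trans hdvd
    rw [Nat.Prime.dvd_factorial Nat.prime_five] at h
    exact le_antisymm hle h
  let e : (G ⧸ K) ≃ Fin 5 := (Finite.equivFin _).trans (finCongr h5)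
  let g : G →* Equiv.Perm (Fin 5) := (e.permCongrHom : _ →* _).comp f
  have hg : Function.Injective g := e.permCongrHom.injective.comp hf
  have hs : ∀ x, Equiv.Perm.sign (g x) = 1 := by
    let s := Equiv.Perm.sign.comp g
    rcases IsSimpleGroup.eq_bot_or_eq_top_of_normal s.ker inferInstance with h | h
    · exfalso
      have h1 : s b ^ 2 = 1 := Int.units_sq _
      rw [← map_pow] at h1
      have h2 : b ^ 2 ∈ s.ker := h1
      rw [h, Subgroup.mem_bot, ← orderOf_dvd_iff_pow_eq_one, hb] at h2
      omega
    · intro x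
      exact (h ▸ Subgroup.mem_top x : x ∈ s.ker)
  let g' : G →* alternatingGroup (Fin 5) := g.codRestrict _ fun x =>
    Equiv.Perm.mem_alternatingGroup.2 (hs x)
  have hg' : Function.Injective g' := fun x y h => hg (congrArg Subtype.val h)
  refine ⟨MulEquiv.ofBijective g' ⟨hg', MonoidHom.range_eq_top.1 ?_⟩⟩
  exact eq_top_of_dvd_card card_alternatingGroup_five _ ⟨a, rfl⟩ ⟨b, rfl⟩ ⟨c, rfl⟩
    (by rw [orderOf_injective _ hg', ha]) (by rw [orderOf_injective _ hg', hb])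
    (by rw [orderOf_injective _ hg', hc])

theorem mem_of_toPSL_mem_map {F : Type*} [Field F] {K : Subgroup SL(2, F)} (hK : -1 ∈ K)
    {B : SL(2, F)} (h : toPSL F B ∈ K.map (toPSL F)) : B ∈ K := by
  obtain ⟨A, hA, h⟩ := h
  rw [← mul_inv_eq_one, ← map_inv, ← map_mul, toPSL_eq_one_iff] at h
  rw [← inv_inv B, ← inv_mul_cancel_left A B⁻¹]
  rcases h with h | h <;> rw [h]
  · exact K.inv_mem (K.mul_mem (K.inv_mem hA) K.one_mem)
  · exact K.inv_mem (K.mul_mem (K.inv_mem hA) hK)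

/-- The matrix with given entries as an element of `SL₂`. -/
def mkSL2 {F : Type*} [Field F] (x y z t : F) (hd : x * t - y * z = 1) : SL(2, F) :=
  ⟨!![x, y; z, t], by rw [Matrix.det_fin_two_of, hd]⟩

theorem mkSL2_apply {F : Type*} [Field F] {x y z t : F} (hd : x * t - y * z = 1) :
    mkSL2 x y z t hd 0 0 = x ∧ mkSL2 x y z t hd 0 1 = y ∧ mkSL2 x y z t hd 1 0 = z ∧
      mkSL2 x y z t hd 1 1 = t := ⟨rfl, rfl, rfl, rfl⟩

/-- The Borel subgroup of upper triangular matrices. -/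
def upperTriangular (F : Type*) [Field F] : Subgroup SL(2, F) where
  carrier := {g | g 1 0 = 0}
  mul_mem' {a b} ha hb := by
    rw [Set.mem_setOf_eq] at *
    rw [SL2_mul_apply, ha, hb]
    ring
  one_mem' := by simp
  inv_mem' {a} ha := by
    rw [Set.mem_setOf_eq] at *
    rw [(SL2_inv_apply a).2.2.1, ha, neg_zero]

theorem PSL_four_mulEquiv {F : Type*} [Field F] [Fintype F] (h : Fintype.card F = 4) :
    Nonempty (PSL(2, F) ≃* alternatingGroup (Fin 5)) := by
  classical
  have : IsSimpleGroup PSL(2, F) :=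
    Matrix.ProjectiveSpecialLinearGroup.rank_two_simple (by rw [Nat.card_eq_fintype_card, h])
  have h2 : (2 : F) = 0 := by
    have := FiniteField.cast_card_eq_zero F
    rw [h] at this
    push_cast at this
    exact pow_eq_zero_iff two_ne_zero |>.1 (by linear_combination this)
  obtain ⟨w, hw⟩ : ∃ w : F, w ^ 2 + w + 1 = 0 := by
    obtain ⟨w, hw0, hw1⟩ : ∃ w : F, w ≠ 0 ∧ w ≠ 1 := by
      by_contra! H
      have : Fintype.card F ≤ ({0, 1} : Finset F).card := by
        rw [← Finset.card_univ]
        refine Finset.card_le_card fun x _ => ?_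
        by_cases hx : x = 0
        · simp [hx]
        · simp [H x hx]
      have := this.trans Finset.card_le_two
      omega
    refine ⟨w, ?_⟩
    have := FiniteField.pow_card_sub_one_eq_one w hw0
    rw [h] at this
    refine (mul_eq_zero.1 (?_ : (w - 1) * _ = 0)).resolve_left (sub_ne_zero.2 hw1)
    linear_combination this
  have hw1 : w ≠ 1 := by
    rintro rfl
    exact one_ne_zero (α := F) (by linear_combination hw - h2)
  have order {n : ℕ} (hn : n.Prime) (B : SL(2, F)) (h1 : B ^ n = 1) (h3 : B ≠ 1) :
      orderOf (toPSL F B) = n := by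
    have := Fact.mk hn
    refine orderOf_eq_prime (by rw [← map_pow, h1, map_one]) fun h => ?_
    rcases toPSL_eq_one_iff.1 h with h | h
    · exact h3 h
    · apply h3
      rw [h]
      ext i j
      fin_cases i <;> fin_cases j <;> simp <;> linear_combination -h2
  refine nonempty_mulEquiv_alternatingGroup_five (ι := Option F) (by simp [h])
    (K := (upperTriangular F).map (toPSL F)) (fun htop => ?_)
    (fun i => i.elim 1 fun x => toPSL F (mkSL2 x (-1) 1 0 (by ring))) (fun g => ?_)
    (order Nat.prime_two (mkSL2 1 1 0 1 (by ring)) ?_ ?_)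
    (order Nat.prime_three (mkSL2 w 0 0 (w ^ 2) (by linear_combination (w - 1) * hw)) ?_ ?_)
    (order Nat.prime_five (mkSL2 0 1 1 w (by linear_combination -h2)) ?_ ?_)
  · have : mkSL2 0 1 1 w (by linear_combination -h2) ∈ upperTriangular F :=
      mem_of_toPSL_mem_map (show (-1 : SL(2, F)) 1 0 = 0 by simp) (htop ▸ Subgroup.mem_top _)
    exact one_ne_zero (α := F) this
  · obtain ⟨g, rfl⟩ := toPSL_surjective g
    by_cases hg : g 1 0 = 0
    · exact ⟨none, g, hg, by simp⟩
    · refine ⟨some (g 0 0 / g 1 0), (mkSL2 (g 0 0 / g 1 0) (-1) 1 0 (by ring))⁻¹ * g, ?_, by simp⟩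
      change ((mkSL2 (g 0 0 / g 1 0) (-1) 1 0 (by ring))⁻¹ * g) 1 0 = 0
      rw [SL2_mul_apply, (SL2_inv_apply _).2.2.1, (SL2_inv_apply _).2.2.2]
      simp [mkSL2_apply]
      field_simp
      try ring
  · apply SL2_ext <;> simp [pow_succ,
      SL2_mul_apply, mkSL2_apply, Matrix.SpecialLinearGroup.coe_mul, Matrix.mul_apply] <;> linear_combination h2
  · intro h
    exact one_ne_zero (α := F) (congrArg (fun B : SL(2, F) => B 0 1) h)
  · apply SL2_ext <;> simp [pow_succ, SL2_mul_apply, mkSL2_apply, Matrix.SpecialLinearGroup.coe_mul, Matrix.mul_apply]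
    · linear_combination (w - 1) * hw
    · linear_combination (w - 1) * (w ^ 3 + 1) * hw
  · intro h
    exact hw1 (congrArg (fun B : SL(2, F) => B 0 0) h)
  · apply SL2_ext <;> simp [pow_succ, SL2_mul_apply, mkSL2_apply, Matrix.SpecialLinearGroup.coe_mul, Matrix.mul_apply]
    · linear_combination (w - 1) * hw + w * h2
    · linear_combination (w ^ 2 - w + 1) * hw + w ^ 2 * h2
    · linear_combination (w ^ 2 - w + 1) * hw + w ^ 2 * h2
    · linear_combination (w ^ 2 * (w - 1) + 1) * hw + (2 * w ^ 3 + w - 1) * h2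
  · intro h
    exact one_ne_zero (α := F) (congrArg (fun B : SL(2, F) => B 0 1) h)

instance : Fact (Nat.Prime 5) := ⟨Nat.prime_five⟩

/-- The six elements of order 4 in a quaternion subgroup of `SL₂(5)`. -/
def quaternionUnits : Finset SL(2, ZMod 5) :=
  {mkSL2 2 0 0 3 (by decide), mkSL2 3 0 0 2 (by decide), mkSL2 0 1 4 0 (by decide),
    mkSL2 0 4 1 0 (by decide), mkSL2 0 2 2 0 (by decide), mkSL2 0 3 3 0 (by decide)}

theorem PSL_five_mulEquiv : Nonempty (PSL(2, ZMod 5) ≃* alternatingGroup (Fin 5)) := by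
  have : IsSimpleGroup PSL(2, ZMod 5) :=
    Matrix.ProjectiveSpecialLinearGroup.rank_two_simple (by simp)
  have order {n : ℕ} (hn : n.Prime) (B : SL(2, ZMod 5)) (h1 : B ^ n = 1 ∨ B ^ n = -1)
      (h2 : ¬ (B = 1 ∨ B = -1)) : orderOf (toPSL (ZMod 5) B) = n := by
    have := Fact.mk hn
    exact orderOf_eq_prime (by rw [← map_pow, toPSL_eq_one_iff]; exact h1)
      (by rwa [Ne, toPSL_eq_one_iff])
  let K : Subgroup SL(2, ZMod 5) := Subgroup.normalizer (quaternionUnits : Set SL(2, ZMod 5))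
  refine nonempty_mulEquiv_alternatingGroup_five (ι := Fin 5) (by simp)
    (K := K.map (toPSL _)) (fun htop => ?_)
    (fun i => toPSL _ (mkSL2 1 1 0 1 (by decide) ^ (i : ℕ))) (fun g => ?_)
    (order Nat.prime_two (mkSL2 0 1 4 0 (by decide)) (by decide +kernel) (by decide +kernel))
    (order Nat.prime_three (mkSL2 0 4 1 1 (by decide)) (by decide +kernel) (by decide +kernel))
    (order Nat.prime_five (mkSL2 1 1 0 1 (by decide)) (by decide +kernel) (by decide +kernel))
  · have hK : -1 ∈ K := by
      rw [Subgroup.mem_set_normalizer_iff]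
      intro q
      simp
    have h := mem_of_toPSL_mem_map hK (B := mkSL2 1 1 0 1 (by decide))
      (htop ▸ Subgroup.mem_top _)
    rw [Subgroup.mem_set_normalizer_iff] at h
    have h1 := (h (mkSL2 2 0 0 3 (by decide))).1
      (Finset.mem_coe.2 (by decide +kernel))
    rw [Finset.mem_coe] at h1
    revert h1
    decide +kernel
  · obtain ⟨g, rfl⟩ := toPSL_surjective g
    have key : ∀ g : SL(2, ZMod 5), ∃ i : Fin 5, ∀ q ∈ quaternionUnits,
        ((mkSL2 1 1 0 1 (by decide) ^ (i : ℕ))⁻¹ * g) * q *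
          ((mkSL2 1 1 0 1 (by decide) ^ (i : ℕ))⁻¹ * g)⁻¹ ∈ quaternionUnits := by
      decide +kernel
    obtain ⟨i, hi⟩ := key g
    exact ⟨i, _, Subgroup.mem_normalizer_fintype hi, by simp⟩

theorem PSL_mulEquiv_alternatingGroup_five {F : Type*} [Field F] [Fintype F]
    (h4 : 4 ≤ Fintype.card F) (h5 : Fintype.card F ≤ 5) :
    Nonempty (PSL(2, F) ≃* alternatingGroup (Fin 5)) := by
  obtain h | h : Fintype.card F = 4 ∨ Fintype.card F = 5 := by omega
  · exact PSL_four_mulEquiv h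
  · obtain ⟨e⟩ := nonempty_PSL_mulEquiv_of_card (F' := ZMod 5) (h.trans (ZMod.card 5).symm)
    obtain ⟨e'⟩ := PSL_five_mulEquiv
    exact ⟨e.trans e'⟩

end Isomorphisms

section Generation

variable {F : Type*} [Field F]

/-- Upper unipotent matrices. -/
def upper (a : F) : SL(2, F) := mkSL2 1 a 0 1 (by ring)

theorem upper_mul (a b : F) : upper a * upper b = upper (a + b) := by
  apply SL2_ext <;> simp [SL2_mul_apply, upper, mkSL2_apply, add_comm]

theorem upper_zero : upper (0 : F) = 1 := by
  apply SL2_ext <;> simp [upper, mkSL2_apply]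

theorem upper_inv (a : F) : (upper a)⁻¹ = upper (-a) := by
  rw [inv_eq_iff_mul_eq_one, upper_mul, add_neg_cancel, upper_zero]

theorem conj_upper (g : SL(2, F)) (a : F) :
    (g * upper a * g⁻¹) 0 0 = 1 - a * g 0 0 * g 1 0 ∧ (g * upper a * g⁻¹) 0 1 = a * g 0 0 ^ 2 ∧
    (g * upper a * g⁻¹) 1 0 = - a * g 1 0 ^ 2 ∧ (g * upper a * g⁻¹) 1 1 = 1 + a * g 0 0 * g 1 0 := by
  obtain ⟨h1, h2, h3, h4⟩ := SL2_inv_apply g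
  have hd := SL2_det g
  simp only [SL2_mul_apply, h1, h2, h3, h4, upper, mkSL2_apply]
  refine ⟨?_, ?_, ?_, ?_⟩
  · linear_combination hd
  · ring
  · ring
  · linear_combination hd

theorem eq_top_of_forall_upper_mem {K : Subgroup SL(2, F)} (hK : ∀ a, upper a ∈ K)
    {g : SL(2, F)} (hg : g ∈ K) (h10 : g 1 0 ≠ 0) : K = ⊤ := by
  obtain ⟨g, hg, h00, h10⟩ : ∃ g ∈ K, g 0 0 = 0 ∧ g 1 0 ≠ 0 := by
    refine ⟨upper (-(g 0 0 / g 1 0)) * g, K.mul_mem (hK _) hg, ?_, ?_⟩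
    · simp only [SL2_mul_apply, upper, mkSL2_apply]
      field_simp
      ring
    · simpa only [SL2_mul_apply, upper, mkSL2_apply, zero_mul, one_mul, zero_add]
  refine eq_top_iff.2 fun A _ => ?_
  refine Matrix.SL2.transvection_induction (· ∈ K) (fun i j hij c => ?_)
    (fun _ _ => K.mul_mem) A
  obtain ⟨rfl, rfl⟩ | ⟨rfl, rfl⟩ : (i = 0 ∧ j = 1) ∨ (i = 1 ∧ j = 0) := by omega
  · convert hK c
    apply SL2_ext <;> simp [upper, mkSL2_apply, Matrix.SpecialLinearGroup.transvection_coe]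
  · convert K.mul_mem (K.mul_mem hg (hK (-c / g 1 0 ^ 2))) (K.inv_mem hg)
    obtain ⟨h1, h2, h3, h4⟩ := conj_upper g (-c / g 1 0 ^ 2)
    apply SL2_ext
    · rw [h1, h00]; simp [Matrix.SpecialLinearGroup.transvection_coe]
    · rw [h2, h00]; simp [Matrix.SpecialLinearGroup.transvection_coe]
    · rw [h3]
      simp [Matrix.SpecialLinearGroup.transvection_coe]
      field_simp
    · rw [h4, h00]; simp [Matrix.SpecialLinearGroup.transvection_coe]

/-- The scalars preserving the set of upper unipotent matrices in `K`. -/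
def unipotentScalars (K : Subgroup SL(2, F)) : Subring F where
  carrier := {s | ∀ a, upper a ∈ K → upper (s * a) ∈ K}
  mul_mem' {s t} hs ht a ha := by rw [mul_assoc]; exact hs _ (ht _ ha)
  one_mem' a ha := by rwa [one_mul]
  add_mem' {s t} hs ht a ha := by rw [add_mul, ← upper_mul]; exact K.mul_mem (hs _ ha) (ht _ ha)
  zero_mem' a _ := by rw [zero_mul, upper_zero]; exact K.one_mem
  neg_mem' {s} hs a ha := by rw [neg_mul, ← upper_inv]; exact K.inv_mem (hs _ ha)

theorem sq_mem_unipotentScalars {K : Subgroup SL(2, F)} {g : SL(2, F)} (hg : g ∈ K)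
    (h10 : g 1 0 = 0) : g 0 0 ^ 2 ∈ unipotentScalars K := fun a ha => by
  convert K.mul_mem (K.mul_mem hg ha) (K.inv_mem hg)
  obtain ⟨h1, h2, h3, h4⟩ := conj_upper g a
  apply SL2_ext
  · rw [h1, h10]; simp [upper, mkSL2_apply]
  · rw [h2]; simp only [upper, mkSL2_apply]; ring
  · rw [h3, h10]; simp [upper, mkSL2_apply]
  · rw [h4, h10]; simp [upper, mkSL2_apply]

theorem eq_top_of_unipotentScalars {K : Subgroup SL(2, F)} (hK : unipotentScalars K = ⊤) {e : F}
    (he : e ≠ 0) (heK : upper e ∈ K) {g : SL(2, F)} (hg : g ∈ K) (h10 : g 1 0 ≠ 0) : K = ⊤ := by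
  refine eq_top_of_forall_upper_mem (fun a => ?_) hg h10
  have : a / e ∈ unipotentScalars K := hK ▸ Subring.mem_top _
  simpa [div_mul_cancel₀ _ he] using this e heK

theorem Subring.eq_top_or_exists_pow_eq [Fintype F] {p : ℕ} [Fact p.Prime] [CharP F p]
    (R : Subring F) : R = ⊤ ∨ ∃ n : ℕ, n ≠ 0 ∧ (p ^ n) ^ 2 ≤ Fintype.card F ∧
      ∀ x ∈ R, x ^ p ^ n = x := by
  classical
  have : Fintype R := Fintype.ofFinite R
  let _ : Field R := Fintype.fieldOfDomain R
  obtain ⟨n, -, hn⟩ := FiniteField.card R p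
  have hpow : Fintype.card F = Fintype.card R ^ Module.finrank R F := Module.card_eq_pow_finrank
  have h1 : 1 < Fintype.card R := Fintype.one_lt_card
  rcases lt_trichotomy (Module.finrank R F) 1 with h | h | h
  · rw [Nat.lt_one_iff] at h
    rw [h, pow_zero] at hpow
    exact absurd (Fintype.one_lt_card (α := F)) (by omega)
  · left
    rw [h, pow_one] at hpow
    rw [eq_top_iff]
    intro x _
    obtain ⟨y, rfl⟩ := ((Fintype.bijective_iff_injective_and_card (Subtype.val : R → F)).2
      ⟨Subtype.val_injective, hpow.symm⟩).2 x
    exact y.2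
  · right
    refine ⟨n, n.ne_zero, ?_, fun x hx => ?_⟩
    · rw [← hn, hpow]
      exact Nat.pow_le_pow_right h1.le h
    · rw [← hn]
      exact congrArg Subtype.val (FiniteField.pow_card (⟨x, hx⟩ : R))

theorem Subring.eq_top_of_sq_mem [Fintype F] {l : F} (hl : orderOf l = Fintype.card F - 1)
    {R : Subring F} (hR : l ^ 2 ∈ R) : R = ⊤ := by
  obtain ⟨p, _⟩ := CharP.exists F
  have := Fact.mk (CharP.char_is_prime F p)
  refine (Subring.eq_top_or_exists_pow_eq (p := p) R).resolve_right ?_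
  rintro ⟨n, hn, h1, h2⟩
  have hp : 1 < p ^ n := Nat.one_lt_pow hn (CharP.char_is_prime F p).one_lt
  generalize p ^ n = Q at *
  have h0 : l ≠ 0 := by
    rintro rfl
    rw [orderOf_zero] at hl
    nlinarith [Fintype.one_lt_card (α := F), Nat.sub_add_cancel (Fintype.card_pos (α := F))]
  have := h2 _ hR
  have h3 : l ^ (2 * (Q - 1)) = 1 := by
    obtain ⟨m, rfl⟩ : ∃ m, Q = m + 1 := ⟨Q - 1, by omega⟩
    rw [add_tsub_cancel_right, pow_mul]
    rw [pow_succ (l ^ 2)] at this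
    exact mul_right_cancel₀ (pow_ne_zero 2 h0) (by rw [this, one_mul])
  have h4 := Nat.le_of_dvd (by omega) (hl ▸ orderOf_dvd_of_pow_eq_one h3)
  obtain ⟨m, rfl⟩ : ∃ m, Q = m + 1 := ⟨Q - 1, by omega⟩
  rw [add_tsub_cancel_right] at h4
  have : (m + 1) ^ 2 ≤ 2 * m + 1 := h1.trans (by omega)
  nlinarith

theorem card_add_one_le_of_pow_eq [Fintype F] {L : Type*} [Field L] [Algebra F L] {z : L}
    (hz : orderOf z = Fintype.card F + 1) {s : F} (hs : algebraMap F L s = z + z⁻¹) {p n : ℕ}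
    [Fact p.Prime] [CharP F p] (hn : n ≠ 0) (h : (s ^ 2 - 2) ^ p ^ n = s ^ 2 - 2) :
    Fintype.card F + 1 ≤ 2 * (p ^ n + 1) := by
  have := charP_of_injective_algebraMap (FaithfulSMul.algebraMap_injective F L) p
  have hp : 1 < p ^ n := Nat.one_lt_pow hn (CharP.char_is_prime F p).one_lt
  have h0 : z ≠ 0 := by
    rintro rfl
    rw [orderOf_zero] at hz
    omega
  have h3 := congrArg (algebraMap F L) h
  have h4 : algebraMap F L (s ^ 2 - 2) = z ^ 2 + (z⁻¹) ^ 2 := by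
    rw [map_sub, map_pow, hs, map_ofNat]
    linear_combination 2 * mul_inv_cancel₀ h0
  rw [map_pow, h4, add_pow_char_pow] at h3
  generalize p ^ n = Q at *
  have h5 : (z ^ (2 * Q) - z ^ 2) * (z ^ (2 * Q) * z ^ 2 - 1) = 0 := by
    have e1 : z ^ (2 * Q) * ((z⁻¹) ^ 2) ^ Q = 1 := by
      rw [← pow_mul, ← mul_pow, mul_inv_cancel₀ h0, one_pow]
    have e2 : z ^ 2 * (z⁻¹) ^ 2 = 1 := by rw [← mul_pow, mul_inv_cancel₀ h0, one_pow]
    rw [← pow_mul] at h3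
    linear_combination z ^ (2 * Q) * z ^ 2 * h3 - z ^ 2 * e1 + z ^ (2 * Q) * e2
  have h6 : z ^ (2 * (Q - 1)) = 1 ∨ z ^ (2 * (Q + 1)) = 1 := by
    rcases mul_eq_zero.1 h5 with h | h
    · left
      obtain ⟨m, rfl⟩ : ∃ m, Q = m + 1 := ⟨Q - 1, by omega⟩
      rw [mul_add, mul_one, pow_add] at h
      rw [add_tsub_cancel_right]
      exact mul_right_cancel₀ (pow_ne_zero 2 h0) (by linear_combination h)
    · right
      rw [mul_add, mul_one, pow_add]
      linear_combination h
  rcases h6 with h | h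
  · exact (Nat.le_of_dvd (by omega) (hz ▸ orderOf_dvd_of_pow_eq_one h)).trans (by omega)
  · exact Nat.le_of_dvd (by omega) (hz ▸ orderOf_dvd_of_pow_eq_one h)

theorem Subring.eq_top_of_add_inv_sq_mem [Fintype F] (hq : 7 ≤ Fintype.card F) {L : Type*} [Field L]
    [Algebra F L] {z : L} (hz : orderOf z = Fintype.card F + 1) {s : F}
    (hs : algebraMap F L s = z + z⁻¹) {R : Subring F} (hR : s ^ 2 ∈ R) : R = ⊤ := by
  obtain ⟨p, _⟩ := CharP.exists F
  have := Fact.mk (CharP.char_is_prime F p)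
  refine (Subring.eq_top_or_exists_pow_eq (p := p) R).resolve_right ?_
  rintro ⟨n, hn, h1, h2⟩
  have hmem : s ^ 2 - 2 ∈ R := R.sub_mem hR (by simpa using R.natCast_mem 2)
  have h7 := card_add_one_le_of_pow_eq hz hs hn (h2 _ hmem)
  generalize p ^ n = Q at *
  have : Q ^ 2 ≤ 2 * Q + 1 := h1.trans (by omega)
  have : 3 ≤ Q := by omega
  nlinarith

end Generation

section SplitGeneration

variable {F : Type*} [Field F]

/-- The diagonal torus. -/
def torus (u : Fˣ) : SL(2, F) := mkSL2 u 0 0 (u⁻¹ : Fˣ) (by simp)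

theorem torus_pow (u : Fˣ) (n : ℕ) : torus (u ^ n) = torus u ^ n := by
  induction n with
  | zero => apply SL2_ext <;> simp [torus, mkSL2_apply]
  | succ n ih =>
    rw [pow_succ, pow_succ, ← ih]
    apply SL2_ext <;> simp [SL2_mul_apply, torus, mkSL2_apply, mul_comm]

theorem torus_conj_apply (g : SL(2, F)) (u : Fˣ) :
    (g * torus u * g⁻¹) 0 0 = g 0 0 * g 1 1 * u - g 0 1 * g 1 0 * (u : F)⁻¹ ∧
    (g * torus u * g⁻¹) 0 1 = g 0 0 * g 0 1 * ((u : F)⁻¹ - u) ∧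
    (g * torus u * g⁻¹) 1 0 = g 1 0 * g 1 1 * (u - (u : F)⁻¹) ∧
    (g * torus u * g⁻¹) 1 1 = g 0 0 * g 1 1 * (u : F)⁻¹ - g 0 1 * g 1 0 * u := by
  obtain ⟨h1, h2, h3, h4⟩ := SL2_inv_apply g
  simp only [SL2_mul_apply, h1, h2, h3, h4, torus, mkSL2_apply, Units.val_inv_eq_inv_val]
  refine ⟨?_, ?_, ?_, ?_⟩ <;> ring

theorem exists_sq_mul_eq [Finite F] (r : Fin 3 → Fˣ) : ∃ i j, i ≠ j ∧ ∃ l : Fˣ, l ^ 2 * r i = r j := by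
  obtain ⟨c, hc⟩ := IsCyclic.exists_generator (α := Fˣ)
  choose n hn using fun i => Subgroup.mem_zpowers_iff.1 (hc (r i))
  obtain ⟨i, j, hij, h⟩ := Fintype.exists_ne_map_eq_of_card_lt (fun i => (n i : ZMod 2)) (by simp)
  obtain ⟨m, hm⟩ := (ZMod.intCast_eq_intCast_iff_dvd_sub _ _ 2).1 h
  refine ⟨i, j, hij, c ^ m, ?_⟩
  rw [← hn, ← hn, ← zpow_natCast, ← zpow_mul, ← zpow_add]
  congr 1
  push_cast at *
  linarith

theorem eq_top_of_torus_mem_of_upper [Fintype F] {K : Subgroup SL(2, F)} {l : Fˣ}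
    (hl : orderOf l = Fintype.card F - 1) (hl2 : l ^ 2 ≠ 1) (hK : torus l ∈ K) {h g : SL(2, F)}
    (hh : h ∈ K) (h10 : h 1 0 = 0) (h01 : h 0 1 ≠ 0) (hg : g ∈ K) (g10 : g 1 0 ≠ 0) : K = ⊤ := by
  have hu : (l : F) ^ 2 - 1 ≠ 0 := by
    rw [sub_ne_zero]
    exact fun h => hl2 (Units.ext (by rw [Units.val_pow_eq_pow_val, h, Units.val_one]))
  have hd := SL2_det h
  rw [h10, mul_zero, sub_zero] at hd
  refine eq_top_of_unipotentScalars (Subring.eq_top_of_sq_mem (l := (l : F))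
    (by rwa [orderOf_units]) ?_)
    (e := (l ^ 2 - 1) * h 0 1 * h 1 1) ?_ (g := g) ?_ hg g10
  · have := sq_mem_unipotentScalars hK (show torus l 1 0 = 0 from rfl)
    rwa [show torus l 0 0 = l from rfl] at this
  · exact mul_ne_zero (mul_ne_zero hu h01) (right_ne_zero_of_mul_eq_one hd)
  · convert K.mul_mem (K.inv_mem hh) (K.mul_mem (K.mul_mem hK hh) (K.inv_mem hK)) using 1
    obtain ⟨h1, h2, h3, h4⟩ := SL2_inv_apply h
    obtain ⟨t1, t2, t3, t4⟩ := SL2_inv_apply (torus l)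
    have hll : (l : F) * (l : F)⁻¹ = 1 := mul_inv_cancel₀ l.ne_zero
    apply SL2_ext <;> simp only [SL2_mul_apply, h1, h2, h3, h4, t1, t2, t3, t4, h10] <;>
      simp only [torus, upper, mkSL2_apply, Units.val_inv_eq_inv_val]
    · linear_combination -hd - h 1 1 * h 0 0 * hll
    · linear_combination h 0 1 * h 1 1 * hll
    · ring
    · linear_combination -hd - h 1 1 * h 0 0 * hll

theorem eq_top_of_torus_mem [Fintype F] {K : Subgroup SL(2, F)} {l : Fˣ}
    (hl : orderOf l = Fintype.card F - 1) (hK : torus l ∈ K)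
    (hne : ∀ j ∈ Finset.Icc 1 6, l ^ (2 * j) ≠ 1) {g : SL(2, F)} (hg : g ∈ K)
    (hdiag : g 0 0 * g 1 1 ≠ 0) (hanti : g 0 1 * g 1 0 ≠ 0) : K = ⊤ := by
  classical
  have hd := SL2_det g
  have hgen : ∀ u : Fˣ, u ∈ Submonoid.powers l := fun u =>
    mem_powers_iff_mem_zpowers.2 (by
      rw [Subgroup.eq_top_of_card_eq (Subgroup.zpowers l) (by
        rw [Nat.card_zpowers, hl, Nat.card_units, Nat.card_eq_fintype_card])]
      exact Subgroup.mem_top u)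
  have hT : ∀ u : Fˣ, torus u ∈ K := by
    intro u
    obtain ⟨n, rfl⟩ := hgen u
    simp only [torus_pow]
    exact K.pow_mem hK n
  have hC : ∀ u : Fˣ, g * torus u * g⁻¹ ∈ K := fun u => K.mul_mem (K.mul_mem hg (hT u)) (K.inv_mem hg)
  set t := g 0 0 * g 1 1 with ht
  set f := g 0 1 * g 1 0 with hf
  have hm : ∀ j ∈ Finset.Icc 1 6, ((l : F) ^ 2) ^ j ≠ 1 := by
    intro j hj h
    apply hne j hj
    rw [← pow_mul] at h
    exact Units.ext (by rw [Units.val_pow_eq_pow_val, h, Units.val_one])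
  generalize hμ : (l : F) ^ 2 = μ at hm
  have hex : ∀ i : Fin 3, ∃ u : Fˣ, ((u : F) ^ 2 = μ ^ (i + 1 : ℕ) ∨ (u : F) ^ 2 * μ ^ (i + 1 : ℕ) = 1) ∧
      t * u ^ 2 - f ≠ 0 := by
    intro i
    have hu : ((l ^ (i + 1 : ℕ) : Fˣ) : F) ^ 2 = μ ^ (i + 1 : ℕ) := by
      push_cast
      rw [← hμ, ← pow_mul, ← pow_mul, mul_comm]
    by_cases h : t * ((l ^ (i + 1 : ℕ) : Fˣ) : F) ^ 2 - f = 0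
    · have hi : ((l ^ (i + 1 : ℕ) : Fˣ) : F) ^ 2 * (((l ^ (i + 1 : ℕ))⁻¹ : Fˣ) : F) ^ 2 = 1 := by
        rw [← mul_pow, Units.mul_inv, one_pow]
      refine ⟨(l ^ (i + 1 : ℕ))⁻¹, Or.inr (by rw [← hu, mul_comm, hi]), fun h' => ?_⟩
      have h4 : (((l ^ (i + 1 : ℕ) : Fˣ) : F) ^ 2) ^ 2 = 1 := by
        apply mul_left_cancel₀ hdiag
        linear_combination ((l ^ (i + 1 : ℕ) : Fˣ) : F) ^ 2 * (h - h') + t * hi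
      rw [hu, ← pow_mul] at h4
      exact hm _ (by rw [Finset.mem_Icc]; omega) h4
    · exact ⟨_, Or.inl hu, h⟩
  choose κ hκ hκf using hex
  have hκ1 : ∀ i, (κ i : F) ^ 2 - 1 ≠ 0 := by
    intro i h
    rw [sub_eq_zero] at h
    have := hκ i
    rw [h, one_mul, eq_comm, or_self] at this
    exact hm _ (by rw [Finset.mem_Icc]; omega) this
  have hμ0 : μ ≠ 0 := by rw [← hμ]; simp
  have hκne : ∀ i j, i ≠ j → (κ i : F) ^ 2 ≠ κ j ^ 2 ∧ (κ i : F) ^ 2 * κ j ^ 2 ≠ 1 := by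
    have main : ∀ i j, i < j → (κ i : F) ^ 2 ≠ κ j ^ 2 ∧ (κ i : F) ^ 2 * κ j ^ 2 ≠ 1 := by
      intro i j hij
      have s1 : μ ^ (i + 1 : ℕ) * μ ^ (j - i : ℕ) = μ ^ (j + 1 : ℕ) := by
        rw [← pow_add]; congr 1; omega
      have s2 := hm (j - i) (by rw [Finset.mem_Icc]; omega)
      have s3 := hm (i + 1 + (j + 1)) (by rw [Finset.mem_Icc]; omega)
      rw [pow_add] at s3
      have n1 : μ ^ (i + 1 : ℕ) ≠ 0 := pow_ne_zero _ hμ0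
      have n2 : μ ^ (j + 1 : ℕ) ≠ 0 := pow_ne_zero _ hμ0
      have hi := hκ i
      have hj := hκ j
      generalize μ ^ (i + 1 : ℕ) = a at *
      generalize μ ^ (j + 1 : ℕ) = b at *
      generalize μ ^ (j - i : ℕ) = d at *
      generalize (κ i : F) ^ 2 = x at *
      generalize (κ j : F) ^ 2 = y at *
      clear * - hi hj s1 s2 s3 n1 n2
      rcases hi with hi | hi <;> rcases hj with hj | hj <;> constructor <;> intro h <;> grind
    intro i j hij
    rcases lt_or_gt_of_ne hij with h | h
    · exact main i j h
    · exact ⟨(main j i h).1.symm, by rw [mul_comm]; exact (main j i h).2⟩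
  have hne0 : g 1 0 * g 1 1 ≠ 0 :=
    mul_ne_zero (right_ne_zero_of_mul hanti) (right_ne_zero_of_mul hdiag)
  have hne1 : g 0 0 * g 0 1 ≠ 0 :=
    mul_ne_zero (left_ne_zero_of_mul hdiag) (left_ne_zero_of_mul hanti)
  obtain ⟨i, j, hij, v, hv⟩ := exists_sq_mul_eq fun i =>
    Units.mk0 ((t * κ i ^ 2 - f) / (κ i ^ 2 - 1)) (div_ne_zero (hκf i) (hκ1 i))
  have hv := congrArg Units.val hv
  push_cast at hv
  simp only [Units.val_mk0] at hv
  rw [mul_div_assoc', div_eq_div_iff (hκ1 i) (hκ1 j)] at hv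
  obtain ⟨a1, a2, a3, a4⟩ := torus_conj_apply g (κ i)
  obtain ⟨b1, b2, b3, b4⟩ := torus_conj_apply g (κ j)
  obtain ⟨hn1, hn2⟩ := hκne i j hij
  have hi1 := hκ1 i
  have hj1 := hκ1 j
  have zi := (κ i).ne_zero
  have zj := (κ j).ne_zero
  have zv := v.ne_zero
  set A := g * torus (κ i) * g⁻¹
  set B := g * torus (κ j) * g⁻¹
  obtain ⟨c1, c2, c3, c4⟩ := SL2_inv_apply B
  rw [← ht, ← hf] at a1 a4 b1 b4
  refine eq_top_of_torus_mem_of_upper hl (by simpa using hne 1 (by simp)) hK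
    (h := B⁻¹ * torus v * A) (K.mul_mem (K.mul_mem (K.inv_mem (hC _)) (hT _)) (hC _)) ?_ ?_ hg
    (right_ne_zero_of_mul hanti)
  · simp only [SL2_mul_apply, c1, c2, c3, c4, a1, a2, a3, a4, b1, b3, torus, mkSL2_apply, Units.val_inv_eq_inv_val]
    field_simp
    linear_combination - g 1 0 * g 1 1 * hv
  · simp only [SL2_mul_apply, c1, c2, c3, c4, a1, a2, a3, a4, b2, b4, torus, mkSL2_apply, Units.val_inv_eq_inv_val]
    intro h
    field_simp at h
    have h' : (v : F) ^ 2 * (t - f * κ j ^ 2) * (κ i ^ 2 - 1) = (κ j ^ 2 - 1) * (t - f * κ i ^ 2) := by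
      apply mul_left_cancel₀ hne1
      linear_combination -h
    have h'' : (v : F) ^ 2 * (((κ i : F) ^ 2 - κ j ^ 2) * (1 - (κ i : F) ^ 2 * κ j ^ 2)) = 0 := by
      linear_combination (κ j ^ 2 - 1) * (t - f * κ i ^ 2) * hv -
        (t * κ j ^ 2 - f) * (κ i ^ 2 - 1) * h' - v ^ 2 * ((κ i : F) ^ 2 - κ j ^ 2) *
        (1 - (κ i : F) ^ 2 * κ j ^ 2) * (t - f + 1) * hd
    exact mul_ne_zero (pow_ne_zero 2 zv) (mul_ne_zero (sub_ne_zero.2 hn1)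
      (sub_ne_zero.2 hn2.symm)) h''

end SplitGeneration

section NonsplitGeneration

variable {F : Type*} [Field F]

/-- An element of trace `s` of `SL₂`. -/
def companion (s c : F) (hc : c ≠ 0) : SL(2, F) :=
  mkSL2 0 (-c⁻¹) c s (by rw [neg_mul, inv_mul_cancel₀ hc]; ring)

theorem Subring.inv_mem_of_finite [Finite F] (R : Subring F) {x : F} (hx : x ∈ R) : x⁻¹ ∈ R := by
  have : Fintype F := Fintype.ofFinite F
  by_cases h : x = 0
  · rw [h, inv_zero]; exact R.zero_mem
  · have h1 := FiniteField.pow_card_sub_one_eq_one x h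
    have h2 := Fintype.one_lt_card (α := F)
    obtain ⟨m, hm⟩ : ∃ m, Fintype.card F - 1 = m + 1 := ⟨Fintype.card F - 2, by omega⟩
    rw [hm, pow_succ] at h1
    rw [inv_eq_of_mul_eq_one_left h1]
    exact R.pow_mem hx m

theorem Subring.mem_of_mul_mem_of_finite [Finite F] (R : Subring F) {x y : F} (hx : x ∈ R)
    (h0 : x ≠ 0) (hxy : x * y ∈ R) : y ∈ R := by
  have := R.mul_mem (R.inv_mem_of_finite hx) hxy
  rwa [inv_mul_cancel_left₀ h0] at this

theorem isSquare_or_exists_eq_sq_mul [Finite F] (a b : F) :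
    (∃ m, a = m ^ 2) ∨ (∃ m, b = m ^ 2) ∨ ∃ m, a = m ^ 2 * b := by
  by_cases ha : a = 0
  · exact Or.inl ⟨0, by simp [ha]⟩
  by_cases hb : b = 0
  · exact Or.inr (Or.inl ⟨0, by simp [hb]⟩)
  obtain ⟨i, j, hij, l, hl⟩ := exists_sq_mul_eq ![1, Units.mk0 a ha, Units.mk0 b hb]
  have hl := congrArg Units.val hl
  have hl0 := l.ne_zero
  fin_cases i <;> fin_cases j <;> simp at hij hl
  · exact Or.inl ⟨l, hl.symm⟩
  · exact Or.inr (Or.inl ⟨l, hl.symm⟩)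
  · exact Or.inl ⟨(l : F)⁻¹, by field_simp; linear_combination hl⟩
  · exact Or.inr (Or.inr ⟨(l : F)⁻¹, by field_simp; linear_combination hl⟩)
  · exact Or.inr (Or.inl ⟨(l : F)⁻¹, by field_simp; linear_combination hl⟩)
  · exact Or.inr (Or.inr ⟨l, hl.symm⟩)

variable [Fintype F] {L : Type*} [Field L] [Algebra F L] {z : L} {s c : F}

/-- The norm of the first column of `g`, for the form preserved by `companion s c`. -/
def columnNorm (s c : F) (g : SL(2, F)) : F := c ^ 2 * g 0 0 ^ 2 + c * s * g 0 0 * g 1 0 + g 1 0 ^ 2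

theorem sq_mem_unipotentScalars_of_columnNorm (hz : orderOf z = Fintype.card F + 1)
    (hs : algebraMap F L s = z + z⁻¹) (hc : c ≠ 0) {K : Subgroup SL(2, F)}
    (hK : companion s c hc ∈ K) {g g' : SL(2, F)} (hg : g ∈ K) (hg' : g' ∈ K) {m : F}
    (h : columnNorm s c g = m ^ 2 * columnNorm s c g') : m ^ 2 ∈ unipotentScalars K := by
  obtain ⟨p, _⟩ := CharP.exists F
  have := Fact.mk (CharP.char_is_prime F p)
  have := charP_of_injective_algebraMap (FaithfulSMul.algebraMap_injective F L) p
  obtain ⟨n, -, hn⟩ := FiniteField.card F p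
  have inj := FaithfulSMul.algebraMap_injective F L
  by_cases hm : m = 0
  · rw [hm, zero_pow two_ne_zero]; exact Subring.zero_mem _
  have hq := Fintype.one_lt_card (α := F)
  have hz1 : z ^ (Fintype.card F + 1) = 1 := hz ▸ pow_orderOf_eq_one z
  have h0 : z ≠ 0 := by
    rintro rfl
    rw [zero_pow (by omega)] at hz1
    exact zero_ne_one hz1
  have hzinv : z ^ Fintype.card F = z⁻¹ := by
    rw [pow_succ] at hz1
    exact eq_inv_of_mul_eq_one_left hz1
  have hzF : ∀ x : F, algebraMap F L x ≠ z := by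
    rintro x rfl
    rw [← map_pow, FiniteField.pow_card, ← map_inv₀] at hzinv
    have hx : x = x⁻¹ := inj hzinv
    have hx2 : algebraMap F L x ^ 2 = 1 := by
      rw [sq]; nth_rw 1 [hx]; rw [map_inv₀, inv_mul_cancel₀ h0]
    have := Nat.le_of_dvd two_pos (hz ▸ orderOf_dvd_of_pow_eq_one hx2)
    omega
  let φ : SL(2, F) → L := fun g => algebraMap F L (c * g 0 0) + z * algebraMap F L (g 1 0)
  have hφ : ∀ g, φ g ^ (Fintype.card F + 1) = algebraMap F L (columnNorm s c g) := by
    intro g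
    have : φ g ^ Fintype.card F = algebraMap F L (c * g 0 0) + z⁻¹ * algebraMap F L (g 1 0) := by
      simp only [φ]
      rw [hn, add_pow_char_pow, ← hn, mul_pow, hzinv, ← map_pow, ← map_pow, FiniteField.pow_card,
        FiniteField.pow_card]
    rw [pow_succ, this]
    simp only [φ, columnNorm, map_add, map_mul, map_pow, hs]
    linear_combination algebraMap F L (g 1 0) ^ 2 * mul_inv_cancel₀ h0
  have hφA : ∀ g j, φ (companion s c hc ^ j * g) = z ^ j * φ g := by
    intro g j
    induction j with
    | zero => simp
    | succ j ih =>
      rw [pow_succ', mul_assoc, pow_succ', mul_assoc, ← ih]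
      generalize companion s c hc ^ j * g = g
      simp only [φ, SL2_mul_apply]
      simp only [companion, mkSL2_apply, map_add, map_mul, hs, map_neg, map_inv₀, map_zero]
      have hc' : algebraMap F L c * (algebraMap F L c)⁻¹ = 1 :=
        mul_inv_cancel₀ fun h => hc (inj (by rw [h, map_zero]))
      linear_combination algebraMap F L (g 1 0) * (mul_inv_cancel₀ h0 - hc')
  have hφinj : ∀ x y x' y' : F, algebraMap F L (c * x) + z * algebraMap F L y =
      algebraMap F L (c * x') + z * algebraMap F L y' → x = x' ∧ y = y' := by
    intro x y x' y' h
    have hy : y = y' := by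
      by_contra hne
      have hne' : algebraMap F L (y - y') ≠ 0 := fun h =>
        hne (sub_eq_zero.1 (inj (by rw [h, map_zero])))
      apply hzF (c * (x' - x) / (y - y'))
      rw [map_div₀, div_eq_iff hne']
      simp only [map_mul, map_sub] at h ⊢
      linear_combination -h
    refine ⟨?_, hy⟩
    rw [hy, add_left_inj] at h
    exact mul_left_cancel₀ hc (inj h)
  have hφ0 : ∀ g, φ g ≠ 0 := by
    intro g hg
    obtain ⟨h1, h2⟩ := hφinj (g 0 0) (g 1 0) 0 0 (by simpa [φ] using hg)
    have := SL2_det g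
    rw [h1, h2] at this
    simp at this
  have hpow : (φ g / (algebraMap F L m * φ g')) ^ (Fintype.card F + 1) = 1 := by
    have hm' : m ^ (Fintype.card F + 1) = m ^ 2 := by rw [pow_succ, FiniteField.pow_card, sq]
    rw [div_pow, mul_pow, hφ, hφ, h, ← map_pow, hm', ← map_mul, div_self]
    rw [map_mul, ← hφ]
    exact mul_ne_zero (fun h => hm (pow_eq_zero_iff two_ne_zero |>.1 (inj (by rw [h, map_zero]))))
      (pow_ne_zero _ (hφ0 _))
  have hprim : IsPrimitiveRoot z (Fintype.card F + 1) := hz ▸ IsPrimitiveRoot.orderOf z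
  obtain ⟨j, -, hj⟩ := hprim.eq_pow_of_pow_eq_one hpow
  rw [eq_div_iff (mul_ne_zero (fun h => hm (inj (by rw [h, map_zero]))) (hφ0 _))] at hj
  set B := companion s c hc ^ j * g' with hB
  have hBK : B ∈ K := K.mul_mem (K.pow_mem hK _) hg'
  have hBg : algebraMap F L m * φ B = φ g := by rw [hφA, ← hj]; ring
  obtain ⟨e1, e2⟩ := hφinj (m * B 0 0) (m * B 1 0) (g 0 0) (g 1 0) (by
    simp only [φ, map_mul] at hBg ⊢
    linear_combination hBg)
  obtain ⟨h1, h2, h3, h4⟩ := SL2_inv_apply B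
  have hd := SL2_det B
  have f1 : (B⁻¹ * g) 0 0 = m := by
    rw [SL2_mul_apply, h1, h2, ← e1, ← e2]; linear_combination m * hd
  have f2 : (B⁻¹ * g) 1 0 = 0 := by
    rw [SL2_mul_apply, h3, h4, ← e1, ← e2]; ring
  rw [← f1]
  exact sq_mem_unipotentScalars (K.mul_mem (K.inv_mem hBK) hg) f2

end NonsplitGeneration

section NonsplitGenerationTop

variable {F : Type*} [Field F]

theorem columnNorm_upper_mul_companion (s c a : F) (hc : c ≠ 0) :
    columnNorm s c 1 = c ^ 2 * 1 ∧
    columnNorm s c (upper a * companion s c hc) = c ^ 2 * (1 + a * s * c + a ^ 2 * c ^ 2) ∧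
    columnNorm s c (upper a * (companion s c hc * companion s c hc)) =
      c ^ 2 * (1 + a * s * c * (s ^ 2 - 2) + a ^ 2 * s ^ 2 * c ^ 2) ∧
    columnNorm s c (upper a * (companion s c hc * (companion s c hc * companion s c hc))) =
      c ^ 2 * (1 + a * s * c * (s ^ 2 - 1) * (s ^ 2 - 3) + a ^ 2 * c ^ 2 * (s ^ 2 - 1) ^ 2) := by
  refine ⟨by simp [columnNorm], ?_, ?_, ?_⟩ <;>
  · simp only [columnNorm, SL2_mul_apply, upper, companion, mkSL2_apply]
    field_simp
    ring

variable [Fintype F] {L : Type*} [Field L] [Algebra F L] {z : L} {s c : F}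

theorem mem_unipotentScalars_or_of_columnNorm (hz : orderOf z = Fintype.card F + 1)
    (hs : algebraMap F L s = z + z⁻¹) (hc : c ≠ 0) {K : Subgroup SL(2, F)}
    (hK : companion s c hc ∈ K) {g g' : SL(2, F)} (hg : g ∈ K) (hg' : g' ∈ K) {a b : F}
    (ha : columnNorm s c g = c ^ 2 * a) (hb : columnNorm s c g' = c ^ 2 * b) :
    a ∈ unipotentScalars K ∨ b ∈ unipotentScalars K ∨ ∃ t ∈ unipotentScalars K, a = t * b := by
  have h1 := (columnNorm_upper_mul_companion s c 0 hc).1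
  rcases isSquare_or_exists_eq_sq_mul a b with ⟨m, rfl⟩ | ⟨m, rfl⟩ | ⟨m, rfl⟩
  · exact Or.inl (sq_mem_unipotentScalars_of_columnNorm hz hs hc hK hg K.one_mem
      (by rw [ha, h1]; ring))
  · exact Or.inr (Or.inl (sq_mem_unipotentScalars_of_columnNorm hz hs hc hK hg' K.one_mem
      (by rw [hb, h1]; ring)))
  · exact Or.inr (Or.inr ⟨_, sq_mem_unipotentScalars_of_columnNorm hz hs hc hK hg hg'
      (by rw [ha, hb]; ring), rfl⟩)

theorem sq_mem_unipotentScalars_of_two_eq_zero (hz : orderOf z = Fintype.card F + 1)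
    (hs : algebraMap F L s = z + z⁻¹) (hc : c ≠ 0) {K : Subgroup SL(2, F)}
    (hK : companion s c hc ∈ K) (hu : upper 1 ∈ K) (h2 : (2 : F) = 0) (hcs : c = s ^ 2 + s) :
    s ^ 2 ∈ unipotentScalars K := by
  have hchar : CharP F 2 := CharTwo.of_one_ne_zero_of_two_eq_zero one_ne_zero h2
  have hsq : ∀ a : F, ∃ m, a = m ^ 2 := fun a => by
    obtain ⟨m, hm⟩ := FiniteField.isSquare_of_char_two ((ringChar.eq F 2).symm ▸ rfl) a
    exact ⟨m, by rw [hm, sq]⟩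
  obtain ⟨h0, h1, h2', -⟩ := columnNorm_upper_mul_companion s c 1 hc
  have key : ∀ {g a}, g ∈ K → columnNorm s c g = c ^ 2 * a → a ∈ unipotentScalars K := by
    intro g a hg ha
    obtain ⟨m, rfl⟩ := hsq a
    exact sq_mem_unipotentScalars_of_columnNorm hz hs hc hK hg K.one_mem (by rw [ha, h0]; ring)
  have m1 := Subring.sub_mem _ (key (K.mul_mem hu hK) h1) (Subring.one_mem _)
  have m2 := Subring.sub_mem _ (key (K.mul_mem hu (K.mul_mem hK hK)) h2') (Subring.one_mem _)
  refine Subring.mem_of_mul_mem_of_finite _ m1 ?_ ?_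
  · have hs0 : s ≠ 0 := fun h => hc (by rw [hcs, h]; ring)
    rw [show 1 + 1 * s * c + 1 ^ 2 * c ^ 2 - 1 = c * s ^ 2 by
      linear_combination c * hcs + c * s * h2]
    exact mul_ne_zero hc (pow_ne_zero 2 hs0)
  · convert m2 using 1
    linear_combination s * c * h2

theorem sq_mem_unipotentScalars_of_three_ne_zero (hz : orderOf z = Fintype.card F + 1)
    (hs : algebraMap F L s = z + z⁻¹) (hc : c ≠ 0) {K : Subgroup SL(2, F)}
    (hK : companion s c hc ∈ K) (hu : upper 1 ∈ K) (h3 : (3 : F) ≠ 0) (hcs : c = -2 * s) :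
    s ^ 2 ∈ unipotentScalars K := by
  have h2 : (2 : F) ≠ 0 := fun h => hc (by rw [hcs, h]; ring)
  obtain ⟨-, h1, -⟩ := columnNorm_upper_mul_companion s c 1 hc
  obtain ⟨-, h1', -⟩ := columnNorm_upper_mul_companion s c (-1) hc
  have hu' : upper (-1) ∈ K := by rw [← upper_inv]; exact K.inv_mem hu
  have nat : ∀ n : ℕ, (n : F) ∈ unipotentScalars K := natCast_mem _
  have e1 : 1 + 1 * s * c + 1 ^ 2 * c ^ 2 = 1 + 2 * s ^ 2 := by rw [hcs]; ring
  have e2 : 1 + -1 * s * c + (-1) ^ 2 * c ^ 2 = 1 + 6 * s ^ 2 := by rw [hcs]; ring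
  rw [e1] at h1
  rw [e2] at h1'
  have n2 : (2 : F) ∈ unipotentScalars K := mod_cast nat 2
  have n6 : (6 : F) ∈ unipotentScalars K := mod_cast nat 6
  rcases mem_unipotentScalars_or_of_columnNorm hz hs hc hK (K.mul_mem hu' hK) (K.mul_mem hu hK)
    h1' h1 with h | h | ⟨t, ht, h⟩
  · refine Subring.mem_of_mul_mem_of_finite _ n6 ?_ (by
      simpa using Subring.sub_mem _ h (Subring.one_mem _))
    rw [show (6 : F) = 2 * 3 by norm_num]
    exact mul_ne_zero h2 h3
  · exact Subring.mem_of_mul_mem_of_finite _ n2 h2 (by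
      simpa using Subring.sub_mem _ h (Subring.one_mem _))
  · refine Subring.mem_of_mul_mem_of_finite _
      (Subring.sub_mem _ n6 (Subring.mul_mem _ n2 ht)) (fun h' => h2 ?_) ?_
    · have : (2 : F) * (t - 1) = 0 := by linear_combination 2 * s ^ 2 * h' - 2 * h
      have : t = 1 := by linear_combination (mul_eq_zero.1 this).resolve_left h2
      rw [this] at h'
      exact (mul_eq_zero.1 (show (2 : F) * 2 = 0 by linear_combination h')).elim id id
    · rw [show (6 - 2 * t) * s ^ 2 = t - 1 by linear_combination h]
      exact Subring.sub_mem _ ht (Subring.one_mem _)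

theorem sq_mem_unipotentScalars_of_three_eq_zero (hq : 9 < Fintype.card F)
    (hz : orderOf z = Fintype.card F + 1)
    (hs : algebraMap F L s = z + z⁻¹) (hc : c ≠ 0) {K : Subgroup SL(2, F)}
    (hK : companion s c hc ∈ K) (hu : upper 1 ∈ K) (h3 : (3 : F) = 0) (hcs : c = -2 * s) :
    s ^ 2 ∈ unipotentScalars K := by
  obtain rfl : c = s := by rw [hcs]; linear_combination -s * h3
  clear hcs
  have := Fact.mk Nat.prime_three
  have hchar : CharP F 3 := (CharP.charP_iff_prime_eq_zero Nat.prime_three).2 (by exact_mod_cast h3)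
  obtain ⟨-, n1, n2, n3⟩ := columnNorm_upper_mul_companion c c 1 hc
  obtain ⟨w, hw⟩ : ∃ w, c ^ 2 = 1 - w := ⟨1 - c ^ 2, by ring⟩
  have e1 : 1 + 1 * c * c + 1 ^ 2 * c ^ 2 = w := by linear_combination 2 * hw + (1 - w) * h3
  have e2 : 1 + 1 * c * c * (c ^ 2 - 2) + 1 ^ 2 * c ^ 2 * c ^ 2 = 1 + w - w ^ 2 := by
    linear_combination (2 * c ^ 2 - 2 * w) * hw + (w * (w - 1)) * h3
  have e3 : 1 + 1 * c * c * (c ^ 2 - 1) * (c ^ 2 - 3) + 1 ^ 2 * c ^ 2 * (c ^ 2 - 1) ^ 2 =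
      1 - w + w ^ 3 := by
    obtain rfl : w = 1 - c ^ 2 := by linear_combination hw
    linear_combination (c ^ 6 - 3 * c ^ 4 + 2 * c ^ 2) * h3
  rw [e1] at n1
  rw [e2] at n2
  rw [e3] at n3
  set R := unipotentScalars K with hR
  have one : (1 : F) ∈ R := R.one_mem
  suffices w ∈ R by rw [hw]; exact R.sub_mem one this
  have m1 := K.mul_mem hu hK
  have d2 := mem_unipotentScalars_or_of_columnNorm hz hs hc hK
    (K.mul_mem hu (K.mul_mem hK hK)) m1 n2 n1
  have d3 := mem_unipotentScalars_or_of_columnNorm hz hs hc hK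
    (K.mul_mem hu (K.mul_mem hK (K.mul_mem hK hK))) m1 n3 n1
  rw [← hR] at d2 d3
  have of_mul : ∀ {x}, x ∈ R → x ≠ 0 → x * w ∈ R → w ∈ R := fun hx h0 =>
    R.mem_of_mul_mem_of_finite hx h0
  have neg_one : w = -1 → w ∈ R := fun h => h ▸ R.neg_mem one
  rcases d2 with h2 | hw | ⟨t, ht, h2⟩
  · obtain ⟨h, hh⟩ : ∃ h, w - w ^ 2 = h := ⟨_, rfl⟩
    have hR : h ∈ R := by
      rw [← hh]; convert R.sub_mem h2 one using 1; ring
    have e : 1 - w + w ^ 3 = 1 - h - h * w := by rw [← hh]; ring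
    rw [e] at d3
    rcases d3 with h3' | hw | ⟨t, ht, h3'⟩
    · by_cases h0 : h = 0
      · rcases mul_eq_zero.1 (show w * (w - 1) = 0 by rw [h0] at hh; linear_combination -hh)
          with h | h
        · rw [h]; exact R.zero_mem
        · rw [sub_eq_zero.1 h]; exact one
      · refine of_mul hR h0 ?_
        convert R.sub_mem (R.sub_mem one hR) h3' using 1; ring
    · exact hw
    · by_cases h0 : t + h = 0
      · refine neg_one ?_
        have h1 : h = 1 := by linear_combination -h3' - w * h0
        have : (w + 1) ^ 2 = 0 := by rw [h1] at hh; linear_combination -hh + w * h3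
        linear_combination pow_eq_zero_iff two_ne_zero |>.1 this
      · refine of_mul (R.add_mem ht hR) h0 ?_
        convert R.sub_mem one hR using 1; linear_combination -h3'
  · exact hw
  · obtain ⟨e, rfl⟩ : ∃ e, t = 1 - e := ⟨1 - t, by ring⟩
    have he : e ∈ R := by convert R.sub_mem one ht using 1; ring
    have hw2 : w ^ 2 = e * w + 1 := by linear_combination -h2
    have e' : 1 - w + w ^ 3 = 1 + e + e ^ 2 * w := by linear_combination (w + e) * hw2
    rw [e'] at d3
    rcases d3 with h3' | hw | ⟨t, ht, h3'⟩
    · by_cases h0 : e = 0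
      · rcases mul_eq_zero.1 (show (w + 1) * (w - 1) = 0 by rw [h0] at hw2; linear_combination hw2)
          with h | h
        · exact neg_one (by linear_combination h)
        · rw [sub_eq_zero.1 h]; exact one
      · refine of_mul (R.pow_mem he 2) (pow_ne_zero 2 h0) ?_
        convert R.sub_mem (R.sub_mem h3' one) he using 1; ring
    · exact hw
    · by_cases h0 : t - e ^ 2 = 0
      · exfalso
        have h1 : e = -1 := by linear_combination h3' + w * h0
        rw [h1] at hw2
        have hw3 : w ^ 3 = -w - 1 := by linear_combination (w - 1) * hw2 + w * h3
        have hcard : Fintype.card F + 1 ≤ 2 * (3 ^ 2 + 1) := by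
          refine card_add_one_le_of_pow_eq hz hs two_ne_zero ?_
          have hadd : ∀ x : F, (x + 1) ^ 3 = x ^ 3 + 1 := fun x => by
            linear_combination (x ^ 2 + x) * h3
          rw [show c ^ 2 - 2 = -(w + 1) by linear_combination hw]
          have h9 : (w + 1) ^ 3 = -w := by rw [hadd, hw3]; ring
          calc (-(w + 1)) ^ 3 ^ 2 = -((w + 1) ^ 3) ^ 3 := by ring
            _ = w ^ 3 := by rw [h9]; ring
            _ = -(w + 1) := by rw [hw3]; ring
        obtain ⟨n, -, hn⟩ := FiniteField.card F 3
        have : 2 < (n : ℕ) := by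
          by_contra! h
          have := Nat.pow_le_pow_right three_pos h
          omega
        have := Nat.pow_le_pow_right three_pos this
        omega
      · refine of_mul (R.sub_mem ht (R.pow_mem he 2)) h0 ?_
        convert R.add_mem one he using 1; linear_combination -h3'

/-- Generation of `SL₂` by a unipotent element and an element generating a nonsplit torus. -/
theorem eq_top_of_companion_mem (hq : 7 ≤ Fintype.card F) (hq' : Fintype.card F ≠ 9)
    (hz : orderOf z = Fintype.card F + 1)
    (hs : algebraMap F L s = z + z⁻¹) (hc : c ≠ 0) {K : Subgroup SL(2, F)}
    (hK : companion s c hc ∈ K) (hu : upper 1 ∈ K)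
    (hcs : c = -2 * s ∨ (2 : F) = 0 ∧ c = s ^ 2 + s) : K = ⊤ := by
  refine eq_top_of_unipotentScalars (Subring.eq_top_of_add_inv_sq_mem hq hz hs ?_) one_ne_zero hu hK
    (by simpa [companion, mkSL2_apply])
  rcases hcs with h | ⟨h2, h⟩
  · by_cases h3 : (3 : F) = 0
    · have := Fact.mk Nat.prime_three
      have hchar : CharP F 3 :=
        (CharP.charP_iff_prime_eq_zero Nat.prime_three).2 (by exact_mod_cast h3)
      obtain ⟨n, -, hn⟩ := FiniteField.card F 3
      have : 9 < Fintype.card F := by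
        by_contra! h
        have : (n : ℕ) < 3 := by
          by_contra! h'
          have := Nat.pow_le_pow_right three_pos h'
          omega
        interval_cases h : (n : ℕ) <;> omega
      exact sq_mem_unipotentScalars_of_three_eq_zero this hz hs hc hK hu h3 h
    · exact sq_mem_unipotentScalars_of_three_ne_zero hz hs hc hK hu h3 h
  · exact sq_mem_unipotentScalars_of_two_eq_zero hz hs hc hK hu h2 h

end NonsplitGenerationTop

section RotatedPairs

variable {H : Type*} [Group H]

/-- The pair of the rotated triple. -/
def rotatePair (p : H × H) : H × H := (p.2, (p.1 * p.2)⁻¹)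

theorem slot_rotatePair (p : H × H) (s : Fin 3) : slot (rotatePair p) s = slot p (s + 1) := by
  fin_cases s <;> simp [slot, rotatePair]

theorem closure_rotatePair {p : H × H} (h : Subgroup.closure {p.1, p.2} = ⊤) :
    Subgroup.closure {(rotatePair p).1, (rotatePair p).2} = ⊤ := by
  rw [eq_top_iff, ← h, Subgroup.closure_le]
  have m1 : p.2 ∈ Subgroup.closure {(rotatePair p).1, (rotatePair p).2} :=
    Subgroup.subset_closure (by simp [rotatePair])
  have m2 : (p.1 * p.2)⁻¹ ∈ Subgroup.closure {(rotatePair p).1, (rotatePair p).2} :=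
    Subgroup.subset_closure (by simp [rotatePair])
  rintro z (rfl | rfl)
  · simpa using Subgroup.mul_mem _ (Subgroup.inv_mem _ m2) (Subgroup.inv_mem _ m1)
  · exact m1

theorem PairEquiv.map_slot {p q : H × H} {α : MulAut H} (h1 : α p.1 = q.1) (h2 : α p.2 = q.2)
    (s : Fin 3) : α (slot p s) = slot q s := by
  fin_cases s <;> simp [slot, h1, h2]

theorem PairEquiv.orderOf_slot {p q : H × H} (h : PairEquiv p q) (s : Fin 3) :
    orderOf (slot p s) = orderOf (slot q s) := by
  obtain ⟨α, h1, h2⟩ := h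
  rw [← PairEquiv.map_slot h1 h2 s, MulEquiv.orderOf_eq]

theorem PairEquiv.isConj_slot {p q : H × H} (h : PairEquiv p q) {s t : Fin 3}
    (hc : IsConj (slot p s) (slot p t)) : IsConj (slot q s) (slot q t) := by
  obtain ⟨α, h1, h2⟩ := h
  rw [← PairEquiv.map_slot h1 h2, ← PairEquiv.map_slot h1 h2]
  exact α.toMonoidHom.map_isConj hc

end RotatedPairs

section SplitTriples

variable {F : Type*} [Field F]

theorem isConj_torus {B : SL(2, F)} {u : Fˣ} (h : tr B = u + (u : F)⁻¹) (h01 : B 0 1 ≠ 0)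
    (hu : u ^ 2 ≠ 1) : IsConj (torus u) B := by
  have h0 := u.ne_zero
  have hu1 : (1 : F) - u ^ 2 ≠ 0 := by
    rw [sub_ne_zero, ← Units.val_one, ← Units.val_pow_eq_pow_val]
    exact fun h => hu (Units.ext h.symm)
  have hd := SL2_det B
  rw [tr] at h
  let P : SL(2, F) := mkSL2 (B 0 1) (B 0 1 / (B 0 1 * ((u : F)⁻¹ - u))) (u - B 0 0)
    (((u : F)⁻¹ - B 0 0) / (B 0 1 * ((u : F)⁻¹ - u))) (by
      field_simp
      ring)
  refine isConj_iff.2 ⟨P, ?_⟩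
  rw [mul_inv_eq_iff_eq_mul]
  have hw : B 1 1 = u + (u : F)⁻¹ - B 0 0 := by rw [← h]; ring
  rw [hw] at hd
  have hz : B 1 0 = (B 0 0 * (u + (u : F)⁻¹ - B 0 0) - 1) / B 0 1 := by
    rw [eq_div_iff h01]; linear_combination -hd
  apply SL2_ext <;> simp only [P, SL2_mul_apply, torus, mkSL2_apply, Units.val_inv_eq_inv_val, hw, hz]
  · ring
  · field_simp
    ring
  · field_simp
    ring
  · field_simp
    ring

/-- The second entry of a pair `(torus l, B)` such that `B` and `torus l * B` have trace `b`. -/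
def splitPartner (l : Fˣ) (b : F) : SL(2, F) :=
  mkSL2 (b / (l + 1)) 1 (b / (l + 1) * (b * l / (l + 1)) - 1) (b * l / (l + 1)) (by ring)

theorem tr_splitPartner {l : Fˣ} (hl : (l : F) + 1 ≠ 0) (b : F) :
    tr (splitPartner l b) = b ∧ tr (torus l * splitPartner l b) = b := by
  have h0 := l.ne_zero
  constructor <;>
  · simp only [tr, SL2_mul_apply, torus, splitPartner, mkSL2_apply, Units.val_inv_eq_inv_val]
    field_simp
    ring

theorem tr_torus (l : Fˣ) : tr (torus l) = l + (l : F)⁻¹ := by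
  simp [tr, torus, mkSL2_apply]

theorem isConj_toPSL {B C : SL(2, F)} (h : IsConj (toPSL F B) (toPSL F C)) :
    tr B ^ 2 = tr C ^ 2 := by
  obtain ⟨g, hg⟩ := isConj_iff.1 h
  obtain ⟨g, rfl⟩ := toPSL_surjective g
  rw [← mul_inv_eq_one, ← map_inv, ← map_mul, ← map_mul, ← map_inv, ← map_mul, toPSL_eq_one_iff] at hg
  rw [← tr_conj g B]
  rcases hg with hg | hg
  · rw [mul_inv_eq_one.1 hg]
  · rw [mul_inv_eq_iff_eq_mul.1 hg]
    simp [tr]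
    ring

theorem closure_toPSL_eq_top {A B : SL(2, F)} (h : Subgroup.closure {A, B} = ⊤) :
    Subgroup.closure {toPSL F A, toPSL F B} = ⊤ := by
  have := (toPSL F).map_closure {A, B}
  rwa [h, Subgroup.map_top_of_surjective _ toPSL_surjective, Set.image_pair, eq_comm] at this

theorem slot_toPSL (A B : SL(2, F)) (s : Fin 3) :
    slot (toPSL F A, toPSL F B) s = toPSL F (slot (A, B) s) := by
  fin_cases s <;> simp [slot]

variable {l : Fˣ}

theorem pow_ne_one_of_orderOf_eq [Fintype F] (hq : Fintype.card F = 8 ∨ 16 ≤ Fintype.card F)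
    (hl : orderOf l = Fintype.card F - 1) {n : ℕ} (h0 : 0 < n) (h : n ≤ 14) (h7 : n ≠ 7)
    (h14 : n ≠ 14) : l ^ n ≠ 1 := by
  intro h'
  have h1 := hl ▸ orderOf_dvd_of_pow_eq_one h'
  have h2 := Nat.le_of_dvd h0 h1
  obtain h3 | h3 := hq
  · rw [h3] at h1
    omega
  · omega

/-- A pair of elements of `PSL₂` with eigenvalues `l` and `v`, whose product has eigenvalue `v`. -/
def splitPair (l v : Fˣ) : PSL(2, F) × PSL(2, F) :=
  (toPSL F (torus l), toPSL F (splitPartner l (v + (v : F)⁻¹)))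

theorem unit_add_one_ne_zero (hl : l ^ 2 ≠ 1) : (l : F) + 1 ≠ 0 := by
  intro h
  apply hl
  ext
  rw [Units.val_pow_eq_pow_val, Units.val_one]
  linear_combination (l - 1 : F) * h

theorem closure_splitPair [Fintype F] (hl : orderOf l = Fintype.card F - 1)
    (hne : ∀ j ∈ Finset.Icc 1 6, l ^ (2 * j) ≠ 1) {v : Fˣ} (h1 : v ^ 4 ≠ 1) (h2 : v ^ 2 ≠ l)
    (h3 : v ^ 2 * l ≠ 1) :
    Subgroup.closure {(splitPair l v).1, (splitPair l v).2} = ⊤ := by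
  have hl1 := unit_add_one_ne_zero (hne 1 (by simp))
  have l0 := l.ne_zero
  have v0 := v.ne_zero
  refine closure_toPSL_eq_top (eq_top_of_torus_mem hl (Subgroup.subset_closure (Or.inl rfl)) hne
    (Subgroup.subset_closure (Or.inr rfl)) ?_ ?_)
  · have hv : (v : F) + (v : F)⁻¹ ≠ 0 := by
      intro h
      apply h1
      ext
      field_simp at h
      push_cast
      linear_combination (v ^ 2 - 1 : F) * h
    simp only [splitPartner, mkSL2_apply]
    exact mul_ne_zero (div_ne_zero hv hl1) (div_ne_zero (mul_ne_zero hv l0) hl1)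
  · simp only [splitPartner, mkSL2_apply]
    intro h
    field_simp at h
    have : ((v : F) ^ 2 - l) * (v ^ 2 * l - 1) = 0 := by
      linear_combination h
    rcases mul_eq_zero.1 this with h | h
    · exact h2 (Units.ext (by push_cast; linear_combination h))
    · exact h3 (Units.ext (by push_cast; linear_combination h))

theorem isConj_slot_splitPair (hl : l ^ 2 ≠ 1) {v : Fˣ} (hv : v ^ 2 ≠ 1) :
    IsConj (toPSL F (torus v)) (slot (splitPair l v) 1) ∧
    IsConj (toPSL F (torus v)) (slot (splitPair l v) 2) := by
  have hl1 := unit_add_one_ne_zero hl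
  have l0 := l.ne_zero
  obtain ⟨h1, h2⟩ := tr_splitPartner hl1 ((v : F) + (v : F)⁻¹)
  rw [splitPair, slot_toPSL, slot_toPSL]
  refine ⟨(toPSL F).map_isConj (isConj_torus h1 ?_ hv),
    (toPSL F).map_isConj (isConj_torus ((tr_inv _).trans h2) ?_ hv)⟩
  · simp [slot, splitPartner, mkSL2_apply]
  · change (torus l * splitPartner l (v + (v : F)⁻¹))⁻¹ 0 1 ≠ 0
    rw [(SL2_inv_apply _).2.1]
    simp [SL2_mul_apply, torus, splitPartner, mkSL2_apply]

theorem orderOf_toPSL_torus {v : Fˣ} (hv : v ^ 2 ≠ 1) {N : ℕ} (hN : orderOf v = N) :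
    orderOf (toPSL F (torus v)) = N / Nat.gcd 2 N := by
  subst hN
  have h0 := v.ne_zero
  have h2 : (v : F) ^ 2 ≠ 1 := fun h => hv (Units.ext (by push_cast; exact h))
  have ht : algebraMap F F (tr (torus v)) = v + (v : F)⁻¹ := tr_torus v
  refine Nat.dvd_antisymm (orderOf_dvd_of_pow_eq_one (toPSL_pow_div_gcd h0 h2 ht ?_)) ?_
  · rw [← orderOf_units, pow_orderOf_eq_one]
  · rw [← orderOf_units]
    exact div_gcd_dvd_orderOf_toPSL h0 h2 ht

/-- The pairs of the first triple of a Beauville structure, for general `q`. -/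
def splitFamily (l : Fˣ) : ℕ → PSL(2, F) × PSL(2, F)
  | 0 => splitPair l l
  | 1 => splitPair l (l ^ 2)
  | _ => rotatePair (splitPair l (l ^ 2))

theorem splitFamily_isGenFamily [Fintype F] (hq : Fintype.card F = 8 ∨ 16 ≤ Fintype.card F)
    (hl : orderOf l = Fintype.card F - 1) : IsGenFamily 3 (splitFamily l) := by
  have ne : ∀ {n : ℕ}, 0 < n → n ≤ 14 → n ≠ 7 → n ≠ 14 → l ^ n ≠ 1 := fun h1 h2 h3 h4 =>
    pow_ne_one_of_orderOf_eq hq hl h1 h2 h3 h4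
  have hne : ∀ j ∈ Finset.Icc 1 6, l ^ (2 * j) ≠ 1 := fun j hj => by
    rw [Finset.mem_Icc] at hj
    exact ne (by omega) (by omega) (by omega) (by omega)
  have ne2 : l ^ 2 ≠ 1 := ne (by norm_num) (by norm_num) (by norm_num) (by norm_num)
  have ne1 : l ≠ 1 := fun h => ne2 (by rw [h, one_pow])
  have ne4 : (l ^ 2) ^ 2 ≠ 1 := by
    rw [← pow_mul]; exact ne (by norm_num) (by norm_num) (by norm_num) (by norm_num)
  have g1 : Subgroup.closure {(splitPair l l).1, (splitPair l l).2} = ⊤ := by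
    refine closure_splitPair hl hne (ne (by norm_num) (by norm_num) (by norm_num) (by norm_num))
      (fun h => ne1 ?_) ?_
    · rwa [sq, mul_eq_right] at h
    · rw [← pow_succ]; exact ne (by norm_num) (by norm_num) (by norm_num) (by norm_num)
  have g2 : Subgroup.closure {(splitPair l (l ^ 2)).1, (splitPair l (l ^ 2)).2} = ⊤ := by
    refine closure_splitPair hl hne ?_ ?_ ?_
    · rw [← pow_mul]; exact ne (by norm_num) (by norm_num) (by norm_num) (by norm_num)
    · intro h
      refine ne (n := 3) (by norm_num) (by norm_num) (by norm_num) (by norm_num) ?_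
      rwa [← pow_mul, pow_succ, mul_eq_right] at h
    · rw [← pow_mul, ← pow_succ]
      exact ne (by norm_num) (by norm_num) (by norm_num) (by norm_num)
  obtain ⟨a1, a2⟩ := isConj_slot_splitPair ne2 ne2
  obtain ⟨b1, b2⟩ := isConj_slot_splitPair ne2 ne4
  have a0 : slot (splitPair l l) 0 = toPSL F (torus l) := rfl
  have b0 : slot (splitPair l (l ^ 2)) 0 = toPSL F (torus l) := rfl
  have key : ¬ IsConj (toPSL F (torus l)) (toPSL F (torus (l ^ 2))) := by
    intro h
    have h := isConj_toPSL h
    have l0 := l.ne_zero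
    rw [tr_torus, tr_torus] at h
    push_cast at h
    field_simp at h
    have : ((l : F) ^ 2 - 1) * (l ^ 6 - 1) = 0 := by linear_combination -h
    rcases mul_eq_zero.1 this with h | h
    · exact ne2 (Units.ext (by push_cast; linear_combination h))
    · exact ne (n := 6) (by norm_num) (by norm_num) (by norm_num) (by norm_num)
        (Units.ext (by push_cast; linear_combination h))
  refine ⟨fun i hi => ?_, fun j hj i hi => ?_⟩
  · interval_cases i
    · exact g1
    · exact g2
    · exact closure_rotatePair g2
  · interval_cases j <;> interval_cases i <;> simp only [splitFamily] <;> intro h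
    · have := h.isConj_slot (s := 0) (t := 1) (a0 ▸ a1)
      rw [b0] at this
      exact key (this.trans b1.symm)
    · have := h.isConj_slot (s := 1) (t := 2) (a1.symm.trans a2)
      rw [slot_rotatePair, slot_rotatePair] at this
      exact key (b0 ▸ (b2.trans this).symm)
    · have := h.isConj_slot (s := 1) (t := 2) (b1.symm.trans b2)
      rw [slot_rotatePair, slot_rotatePair] at this
      exact key (b0 ▸ (b2.trans this).symm)

theorem IsConj.orderOf_eq {G : Type*} [Group G] {x y : G} (h : IsConj x y) :
    orderOf x = orderOf y := by
  obtain ⟨g, hg⟩ := h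
  exact hg.orderOf_eq

theorem orderOf_slot_splitPair [Fintype F] (hl : orderOf l = Fintype.card F - 1) (hl2 : l ^ 2 ≠ 1)
    (p : ℕ) (s : Fin 3) : orderOf (slot (splitPair l l) s) = pslExp p (Fintype.card F) 1 := by
  have h : _ = pslExp p (Fintype.card F) 1 := orderOf_toPSL_torus hl2 hl
  obtain ⟨h1, h2⟩ := isConj_slot_splitPair hl2 hl2
  rw [← h]
  fin_cases s
  · rfl
  · exact h1.orderOf_eq.symm
  · exact h2.orderOf_eq.symm

theorem toPSL_torus_pow [Fintype F] {v : Fˣ} (hv : v ^ 2 ≠ 1) (p : ℕ) :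
    toPSL F (torus v) ^ pslExp p (Fintype.card F) 1 = 1 := by
  refine toPSL_pow_div_gcd (K := F) v.ne_zero (fun h => hv (Units.ext (by push_cast; exact h)))
    (tr_torus v) ?_
  exact FiniteField.pow_card_sub_one_eq_one _ v.ne_zero

theorem slot_splitPair_pow [Fintype F] (hl2 : l ^ 2 ≠ 1) {v : Fˣ} (hv : v ^ 2 ≠ 1) (p : ℕ)
    (s : Fin 3) : slot (splitPair l v) s ^ pslExp p (Fintype.card F) 1 = 1 := by
  obtain ⟨h1, h2⟩ := isConj_slot_splitPair hl2 hv
  fin_cases s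
  · exact toPSL_torus_pow hl2 p
  · exact orderOf_dvd_iff_pow_eq_one.1
      (h1.orderOf_eq ▸ orderOf_dvd_of_pow_eq_one (toPSL_torus_pow hv p))
  · exact orderOf_dvd_iff_pow_eq_one.1
      (h2.orderOf_eq ▸ orderOf_dvd_of_pow_eq_one (toPSL_torus_pow hv p))

theorem splitFamily_followsPattern [Fintype F] (hl : orderOf l = Fintype.card F - 1)
    (hl4 : l ^ 4 ≠ 1) (p : ℕ) :
    FollowsPattern (pslExp p (Fintype.card F)) 3 (splitFamily l) (fun _ _ => 1)
      fun j _ => j == 0 := by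
  have hl2 : l ^ 2 ≠ 1 := fun h => hl4 (by rw [show 4 = 2 * 2 by rfl, pow_mul, h, one_pow])
  have hll : (l ^ 2) ^ 2 ≠ 1 := by rwa [← pow_mul]
  intro j hj s
  interval_cases j
  · refine ⟨slot_splitPair_pow hl2 hl2 p s, fun _ => ?_⟩
    exact (orderOf_slot_splitPair hl hl2 p s).symm.dvd
  · exact ⟨slot_splitPair_pow hl2 hll p s, by simp⟩
  · refine ⟨?_, by simp⟩
    simp only [splitFamily, slot_rotatePair]
    exact slot_splitPair_pow hl2 hll p _

end SplitTriples

section NonsplitTriples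

variable {F : Type*} [Field F] [Fintype F]

theorem FiniteField.mem_range_algebraMap_of_pow_card_eq {L : Type*} [Field L] [Algebra F L] {x : L}
    (hx : x ^ Fintype.card F = x) : ∃ s : F, algebraMap F L s = x := by
  have hsp : (Polynomial.X ^ Fintype.card F - Polynomial.X : Polynomial F).Splits := by
    rw [Polynomial.splits_iff_card_roots, FiniteField.roots_X_pow_card_sub_X,
      FiniteField.X_pow_card_sub_X_natDegree_eq F Fintype.one_lt_card]
    rfl
  exact hsp.mem_range_of_isRoot (FiniteField.X_pow_card_sub_X_ne_zero F Fintype.one_lt_card)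
    (x := x) (by simp [hx])

theorem exists_orderOf_eq_card_add_one (F : Type*) [Field F] [Fintype F] :
    ∃ (z : AlgebraicClosure F) (s : F), orderOf z = Fintype.card F + 1 ∧
      algebraMap F (AlgebraicClosure F) s = z + z⁻¹ := by
  have inj := FaithfulSMul.algebraMap_injective F (AlgebraicClosure F)
  obtain ⟨p, _⟩ := CharP.exists F
  have := Fact.mk (CharP.char_is_prime F p)
  have := charP_of_injective_algebraMap inj p
  have : NeZero ((Fintype.card F + 1 : ℕ) : AlgebraicClosure F) := by
    constructor
    rw [← map_natCast (algebraMap F (AlgebraicClosure F)), Nat.cast_succ,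
      FiniteField.cast_card_eq_zero, zero_add, map_one]
    exact one_ne_zero
  obtain ⟨z, hz⟩ := HasEnoughRootsOfUnity.exists_primitiveRoot (AlgebraicClosure F) (Fintype.card F + 1)
  have h0 : z ≠ 0 := hz.ne_zero (by omega)
  have h1 : z ^ Fintype.card F = z⁻¹ := eq_inv_of_mul_eq_one_left (by rw [← pow_succ, hz.pow_eq_one])
  obtain ⟨s, hs⟩ := FiniteField.mem_range_algebraMap_of_pow_card_eq (F := F) (x := z + z⁻¹) (by
    obtain ⟨f, -, hf⟩ := FiniteField.card F p
    rw [hf, add_pow_char_pow, ← hf, inv_pow, h1, inv_inv, add_comm])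
  exact ⟨z, s, hz.eq_orderOf.symm, hs⟩

theorem orderOf_toPSL_of_orderOf_eq {L : Type*} [Field L] [Algebra F L] {B : SL(2, F)} {z : L} {N : ℕ}
    (hN : orderOf z = N) (h2 : 2 < N) (h : algebraMap F L (tr B) = z + z⁻¹ ∨
      algebraMap F L (tr B) = - (z + z⁻¹)) :
    orderOf (toPSL F B) = N / Nat.gcd 2 N := by
  have hz1 : z ^ N = 1 := hN ▸ pow_orderOf_eq_one z
  have h0 : z ≠ 0 := by
    rintro rfl
    rw [zero_pow (by omega)] at hz1
    exact zero_ne_one hz1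
  have hz2 : z ^ 2 ≠ 1 := fun h => by
    have := Nat.le_of_dvd two_pos (hN ▸ orderOf_dvd_of_pow_eq_one h)
    omega
  have key : ∀ a, toPSL F B ^ a = 1 ↔ z ^ (2 * a) = 1 := by
    rcases h with h | h
    · exact toPSL_pow_eq_one_iff h0 hz2 h
    · intro a
      rw [toPSL_pow_eq_one_iff (neg_ne_zero.2 h0) (by rwa [neg_sq]) (by rw [h, inv_neg]; ring),
        Even.neg_pow (even_two_mul a)]
  refine Nat.dvd_antisymm (orderOf_dvd_of_pow_eq_one ?_) (div_gcd_dvd_of_dvd_two_mul ?_)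
  · rw [key]
    obtain ⟨c, hc⟩ := dvd_two_mul_div_gcd N
    rw [hc, pow_mul, hz1, one_pow]
  · have := (key _).1 (pow_orderOf_eq_one (toPSL F B))
    rwa [← orderOf_dvd_iff_pow_eq_one, hN] at this

theorem exists_nonsplitPair (hq : 7 ≤ Fintype.card F) (hq' : Fintype.card F ≠ 9) {p : ℕ}
    [Fact p.Prime] [CharP F p] : ∃ P : PSL(2, F) × PSL(2, F), Subgroup.closure {P.1, P.2} = ⊤ ∧
      ∀ s, orderOf (slot P s) = pslExp p (Fintype.card F) (![0, 2, 2] s) := by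
  obtain ⟨z, s, hz, hs⟩ := exists_orderOf_eq_card_add_one F
  have inj := FaithfulSMul.algebraMap_injective F (AlgebraicClosure F)
  have hz1 : z ^ (Fintype.card F + 1) = 1 := hz ▸ pow_orderOf_eq_one z
  have h0 : z ≠ 0 := by
    rintro rfl
    rw [zero_pow (by omega)] at hz1
    exact zero_ne_one hz1
  have hs0 : s ≠ 0 := by
    rintro rfl
    rw [map_zero] at hs
    have h4 : z ^ 4 = 1 := by
      field_simp at hs
      linear_combination -(z ^ 2 - 1) * hs
    have := Nat.le_of_dvd (by omega) (hz ▸ orderOf_dvd_of_pow_eq_one h4)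
    omega
  have ord0 : orderOf (toPSL F (upper 1)) = p := by
    refine orderOf_eq_prime (toPSL_pow_char_eq_one (one_pow 2) (by simp [tr, upper, mkSL2_apply])) ?_
    rw [Ne, toPSL_eq_one_iff]
    have h1 : upper (1 : F) 0 1 = 1 := rfl
    rintro (h | h) <;> rw [h] at h1 <;> simp at h1
  have ord1 : ∀ c hc, orderOf (toPSL F (companion s c hc)) = pslExp p (Fintype.card F) 2 :=
    fun c hc => orderOf_toPSL_of_orderOf_eq hz (by omega)
      (Or.inl (by rw [← hs]; simp [tr, companion, mkSL2_apply]))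
  suffices ∃ (c : F) (hc : c ≠ 0), (c = -2 * s ∨ (2 : F) = 0 ∧ c = s ^ 2 + s) ∧
      orderOf (toPSL F (upper 1 * companion s c hc)) = pslExp p (Fintype.card F) 2 by
    obtain ⟨c, hc, hcs, ord2⟩ := this
    refine ⟨(toPSL F (upper 1), toPSL F (companion s c hc)), closure_toPSL_eq_top
      (eq_top_of_companion_mem hq hq' hz hs hc (Subgroup.subset_closure (Or.inr rfl))
        (Subgroup.subset_closure (Or.inl rfl)) hcs), fun t => ?_⟩
    fin_cases t
    · exact ord0
    · exact ord1 c hc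
    · change orderOf (toPSL F (upper 1) * toPSL F (companion s c hc))⁻¹ = _
      rw [orderOf_inv, ← map_mul, ord2]
      rfl
  have htr : ∀ c hc, tr (upper 1 * companion s c hc) = s + c := fun c hc => by
    simp [tr, companion, upper, mkSL2_apply, SL2_mul_apply]
    ring
  by_cases h2 : (2 : F) = 0
  · have hs1 : s ≠ -1 := by
      rintro rfl
      rw [map_neg, map_one] at hs
      have h3 : z ^ 3 = 1 := by
        field_simp at hs
        linear_combination -(z - 1) * hs
      have := Nat.le_of_dvd (by omega) (hz ▸ orderOf_dvd_of_pow_eq_one h3)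
      omega
    refine ⟨s ^ 2 + s, ?_, Or.inr ⟨h2, rfl⟩, ?_⟩
    · rw [show s ^ 2 + s = s * (s + 1) by ring]
      exact mul_ne_zero hs0 fun h => hs1 (by linear_combination h)
    · refine orderOf_toPSL_of_orderOf_eq (z := z ^ 2) ?_ (by omega) (Or.inl ?_)
      · rw [Nat.Coprime.orderOf_pow, hz]
        rw [hz, Nat.coprime_comm, Nat.coprime_two_left, Nat.odd_add_one, Nat.not_odd_iff_even]
        have hchar : CharP F 2 := CharTwo.of_one_ne_zero_of_two_eq_zero one_ne_zero h2
        exact Nat.even_iff.2 (FiniteField.even_card_of_char_two (ringChar.eq F 2))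
      · rw [htr, show s + (s ^ 2 + s) = s ^ 2 + 2 * s by ring, h2, zero_mul, add_zero, map_pow, hs]
        have : (2 : AlgebraicClosure F) = 0 := by
          rw [← map_ofNat (algebraMap F _), h2, map_zero]
        rw [← inv_pow]
        linear_combination this * z * z⁻¹
  · have hc : -2 * s ≠ 0 := mul_ne_zero (neg_ne_zero.2 h2) hs0
    refine ⟨-2 * s, hc, Or.inl rfl, ?_⟩
    refine orderOf_toPSL_of_orderOf_eq hz (by omega) (Or.inr ?_)
    rw [htr, ← hs, ← map_neg]
    congr 1
    ring

/-- The successive rotations of the pair `P`. -/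
def rotateFamily {H : Type*} [Group H] (P : H × H) (i : ℕ) : H × H := rotatePair^[i] P

theorem slot_rotateFamily {H : Type*} [Group H] (P : H × H) (i : ℕ) (s : Fin 3) :
    slot (rotateFamily P i) s = slot P (s + Fin.ofNat 3 i) := by
  induction i generalizing s with
  | zero => simp [rotateFamily]
  | succ i ih =>
    rw [rotateFamily, Function.iterate_succ_apply', slot_rotatePair, ← rotateFamily, ih]
    congr 1
    ext
    simp only [Fin.val_add, Fin.val_ofNat, Fin.val_one]
    omega

theorem closure_rotateFamily {H : Type*} [Group H] {P : H × H}
    (h : Subgroup.closure {P.1, P.2} = ⊤) (i : ℕ) :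
    Subgroup.closure {(rotateFamily P i).1, (rotateFamily P i).2} = ⊤ := by
  induction i with
  | zero => exact h
  | succ i ih =>
    rw [rotateFamily, Function.iterate_succ_apply']
    exact closure_rotatePair ih

theorem exists_mul_ne_mul_PSL (F : Type*) [Field F] : ∃ a b : PSL(2, F), a * b ≠ b * a := by
  refine ⟨toPSL F (upper 1), toPSL F (mkSL2 0 (-1) 1 0 (by ring)), fun h => ?_⟩
  rw [← mul_inv_eq_one, ← map_mul, ← map_mul, ← map_inv, ← map_mul, toPSL_eq_one_iff] at h
  rcases h with h | h <;> rw [mul_inv_eq_iff_eq_mul] at h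
  · have := congrArg (fun B : SL(2, F) => B 0 0) h
    simp [SL2_mul_apply, upper, mkSL2_apply] at this
  · replace h := h.trans (neg_one_mul _)
    have := congrArg (fun B : SL(2, F) => B 0 0) h
    have neg : ∀ B : SL(2, F), (-B) 0 0 = - B 0 0 := fun _ => rfl
    simp [SL2_mul_apply, upper, mkSL2_apply, neg] at this

theorem hasBeauvillePowers_PSL_of_generic (hq : Fintype.card F = 8 ∨ 16 ≤ Fintype.card F) :
    HasBeauvillePowers PSL(2, F) 1 := by
  obtain ⟨p, _⟩ := CharP.exists F
  have := Fact.mk (CharP.char_is_prime F p)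
  obtain ⟨f, -, hf⟩ := FiniteField.card F p
  obtain ⟨l, hl⟩ := IsCyclic.exists_ofOrder_eq_natCard (α := Fˣ)
  rw [Nat.card_units, Nat.card_eq_fintype_card] at hl
  have ne : ∀ {n : ℕ}, 0 < n → n ≤ 4 → l ^ n ≠ 1 := fun h1 h2 =>
    pow_ne_one_of_orderOf_eq hq hl h1 (by omega) (by omega) (by omega)
  have hp2 : 2 ≤ p := (CharP.char_is_prime F p).two_le
  obtain ⟨P, hP, hord⟩ := exists_nonsplitPair (F := F) (p := p) (by omega) (by omega)
  have hgen := splitFamily_isGenFamily hq hl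
  have hm : 4 ≤ pslExp p (Fintype.card F) 1 := by
    change 4 ≤ (Fintype.card F - 1) / Nat.gcd 2 (Fintype.card F - 1)
    rcases hq with hq | hq
    · rw [hq]
      decide
    · rw [Nat.le_div_iff_mul_le (Nat.gcd_pos_of_pos_left _ two_pos)]
      have := Nat.gcd_le_left (Fintype.card F - 1) two_pos
      omega
  have hn : 5 ≤ pslExp p (Fintype.card F) 2 := by
    change 5 ≤ (Fintype.card F + 1) / Nat.gcd 2 (Fintype.card F + 1)
    rcases hq with hq | hq
    · rw [hq]
      decide
    · rw [Nat.le_div_iff_mul_le (Nat.gcd_pos_of_pos_left _ two_pos)]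
      have := Nat.gcd_le_left (Fintype.card F + 1) two_pos
      omega
  have cop : ∀ c c', c ≠ c' →
      (pslExp p (Fintype.card F) c).Coprime (pslExp p (Fintype.card F) c') := by
    rw [hf]
    exact pslExp_coprime (CharP.char_is_prime F p) f.ne_zero
  have : IsSimpleGroup PSL(2, F) :=
    Matrix.ProjectiveSpecialLinearGroup.rank_two_simple (by rw [Nat.card_eq_fintype_card]; omega)
  have hgen' : IsGenFamily 3 (rotateFamily P) := by
    refine ⟨fun i _ => closure_rotateFamily hP i, fun j hj i hi h => ?_⟩
    have := h.orderOf_slot (-Fin.ofNat 3 i)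
    rw [slot_rotateFamily, slot_rotateFamily, hord, hord] at this
    have hc := cop 0 2 (by decide)
    have h02 : pslExp p (Fintype.card F) 0 = pslExp p (Fintype.card F) 2 := by
      interval_cases j <;> interval_cases i <;> exact this
    rw [h02, Nat.coprime_self] at hc
    omega
  have hm' : ((pslExp p (Fintype.card F) 1 : ℕ) : ℚ)⁻¹ ≤ 4⁻¹ := by
    gcongr
    exact_mod_cast hm
  have hn' : ((pslExp p (Fintype.card F) 2 : ℕ) : ℚ)⁻¹ ≤ 5⁻¹ := by
    gcongr
    exact_mod_cast hn
  have hp' : ((pslExp p (Fintype.card F) 0 : ℕ) : ℚ)⁻¹ ≤ 2⁻¹ := by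
    gcongr
    exact_mod_cast hp2
  have om := orderOf_slot_splitPair hl (ne (n := 2) (by norm_num) (by norm_num)) p
  intro k hk hc
  refine hasBeauvilleStructure_of_pattern (exists_mul_ne_mul_PSL F) cop (fun h => pslExp_cover h) (r := 3) (by norm_num)
    hgen hgen' (isHyperbolic_of_orderOf (om 0) (om 1) (om 2) ?_)
    (isHyperbolic_of_orderOf (hord 0) (hord 1) (hord 2) ?_)
    (splitFamily_followsPattern hl (ne (by norm_num) (by norm_num)) p)
    (followsPattern_of_orderOf (d := fun j s => ![0, 2, 2] (s + Fin.ofNat 3 j)) ?_) (k₀ := 1)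
    (by norm_num) (by decide +kernel) (by decide +kernel) hk hc
  · linarith
  · change ((pslExp p (Fintype.card F) 0 : ℕ) : ℚ)⁻¹ + ((pslExp p (Fintype.card F) 2 : ℕ) : ℚ)⁻¹ +
      ((pslExp p (Fintype.card F) 2 : ℕ) : ℚ)⁻¹ < 1
    linarith
  · intro j _ s
    rw [slot_rotateFamily, hord]

end NonsplitTriples

section CornerFamily

variable {H : Type*} [Group H]

/-- The pair `P` followed by the rotations of `Q`. -/
def cornerFamily (P Q : H × H) : ℕ → H × H
  | 0 => P
  | i + 1 => rotateFamily Q i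

/-- The classes of the orders in a corner family. -/
def cornerPattern (X Y : Fin 3) : ℕ → Fin 3 → Fin 3
  | 0 => fun _ => X
  | i + 1 => fun s => ![X, X, Y] (s + Fin.ofNat 3 i)

theorem orderOf_slot_cornerFamily {P Q : H × H} {e : Fin 3 → ℕ} {X Y : Fin 3}
    (hP : ∀ s, orderOf (slot P s) = e X) (hQ : ∀ s, orderOf (slot Q s) = e (![X, X, Y] s))
    (j : ℕ) (s : Fin 3) : orderOf (slot (cornerFamily P Q j) s) = e (cornerPattern X Y j s) := by
  cases j with
  | zero => exact hP s
  | succ j => rw [cornerFamily, slot_rotateFamily, hQ]; rfl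

theorem cornerFamily_isGenFamily {P Q : H × H} {e : Fin 3 → ℕ} (he : Function.Injective e)
    {X Y : Fin 3} (hXY : X ≠ Y) (hP : Subgroup.closure {P.1, P.2} = ⊤)
    (hQ : Subgroup.closure {Q.1, Q.2} = ⊤) (oP : ∀ s, orderOf (slot P s) = e X)
    (oQ : ∀ s, orderOf (slot Q s) = e (![X, X, Y] s)) : IsGenFamily 4 (cornerFamily P Q) := by
  refine ⟨fun i _ => ?_, fun j hj i hi h => ?_⟩
  · cases i with
    | zero => exact hP
    | succ i => exact closure_rotateFamily hQ i
  · have key : ∀ s, cornerPattern X Y i s = cornerPattern X Y j s := fun s => he (by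
      rw [← orderOf_slot_cornerFamily oP oQ, ← orderOf_slot_cornerFamily oP oQ]
      exact h.orderOf_slot s)
    clear h oP oQ
    revert i j X Y
    decide +kernel

theorem hasBeauvillePowers_of_corners [Finite H] [IsSimpleGroup H] (hna : ∃ a b : H, a * b ≠ b * a)
    {e : Fin 3 → ℕ} (cop : ∀ c c', c ≠ c' → (e c).Coprime (e c')) (cover : ∀ h : H, ∃ c, h ^ e c = 1)
    (he : ∀ c, e c ≠ 1) {X Y Z : Fin 3} (hXY : X ≠ Y) (hXZ : X ≠ Z) (hYZ : Y ≠ Z)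
    (hX : 4 ≤ e X) (hY : 4 ≤ e Y) {P₁ Q₁ P₂ Q₂ : H × H}
    (gP₁ : Subgroup.closure {P₁.1, P₁.2} = ⊤) (gQ₁ : Subgroup.closure {Q₁.1, Q₁.2} = ⊤)
    (gP₂ : Subgroup.closure {P₂.1, P₂.2} = ⊤) (gQ₂ : Subgroup.closure {Q₂.1, Q₂.2} = ⊤)
    (oP₁ : ∀ s, orderOf (slot P₁ s) = e X) (oQ₁ : ∀ s, orderOf (slot Q₁ s) = e (![X, X, Y] s))
    (oP₂ : ∀ s, orderOf (slot P₂ s) = e Y) (oQ₂ : ∀ s, orderOf (slot Q₂ s) = e (![Y, Y, Z] s)) :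
    HasBeauvillePowers H 1 := by
  have inj : Function.Injective e := fun c c' h => by
    by_contra hcc
    have := cop c c' hcc
    rw [← h, Nat.coprime_self] at this
    exact he c this
  have hyp : ∀ {P : H × H} {n : ℕ}, 4 ≤ n → (∀ s, orderOf (slot P s) = n) →
      IsHyperbolic (pairTriple P) := fun hn h => by
    refine isHyperbolic_of_orderOf (h 0) (h 1) (h 2) ?_
    have : ((_ : ℕ) : ℚ)⁻¹ ≤ 4⁻¹ := inv_anti₀ (by norm_num) (by exact_mod_cast hn)
    linarith
  have hdet : ∀ X Y Z : Fin 3, X ≠ Y → X ≠ Z → Y ≠ Z → ∀ c s s', Detects (cornerPattern X Y)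
      (cornerPattern Y Z) (fun _ _ => true) (fun _ _ => true) 4 c s s' := by decide +kernel
  have hav : ∀ X Y Z : Fin 3, X ≠ Y → X ≠ Z → Y ≠ Z → ∀ k < 4, 1 ≤ k → ∀ c s s',
      Detects (cornerPattern X Y) (cornerPattern Y Z) (fun _ _ => true) (fun _ _ => true) k c s s' ∨
        Avoids (cornerPattern X Y) (cornerPattern Y Z) k c s s' := by decide +kernel
  intro k hk hc
  exact hasBeauvilleStructure_of_pattern hna cop cover (r := 4) (by norm_num)
    (cornerFamily_isGenFamily inj hXY gP₁ gQ₁ oP₁ oQ₁)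
    (cornerFamily_isGenFamily inj hYZ gP₂ gQ₂ oP₂ oQ₂) (hyp hX oP₁) (hyp hY oP₂)
    (followsPattern_of_orderOf fun j _ s => orderOf_slot_cornerFamily oP₁ oQ₁ j s)
    (followsPattern_of_orderOf fun j _ s => orderOf_slot_cornerFamily oP₂ oQ₂ j s) (k₀ := 1)
    (by norm_num) (hdet X Y Z hXY hXZ hYZ) (hav X Y Z hXY hXZ hYZ) hk hc

end CornerFamily

section SmallFields

variable {F : Type*} [Field F]

/-- The images in `PSL₂` of the entries of the triple of `P` have the orders `n`. -/
def HasOrders (P : SL(2, F) × SL(2, F)) (n : Fin 3 → ℕ) : Prop :=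
  ∀ s, 0 < n s ∧ (slot P s ^ n s = 1 ∨ slot P s ^ n s = -1) ∧
    ∀ m < n s, 0 < m → ¬(slot P s ^ m = 1 ∨ slot P s ^ m = -1)

instance [DecidableEq F] (P : SL(2, F) × SL(2, F)) (n : Fin 3 → ℕ) : Decidable (HasOrders P n) := by
  unfold HasOrders
  infer_instance

theorem HasOrders.orderOf_eq {P : SL(2, F) × SL(2, F)} {n : Fin 3 → ℕ} (h : HasOrders P n)
    (s : Fin 3) : orderOf (slot (toPSL F P.1, toPSL F P.2) s) = n s := by
  obtain ⟨h1, h2, h3⟩ := h s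
  rw [slot_toPSL, orderOf_eq_iff h1]
  simp only [← map_pow, Ne, toPSL_eq_one_iff]
  exact ⟨h2, h3⟩

theorem hasBeauvillePowers_PSL_of_corners [Fintype F] {p q : ℕ} [Fact p.Prime] [CharP F p]
    (hF : Fintype.card F = q) (hq : 7 ≤ q) {X Y Z : Fin 3} (hXY : X ≠ Y) (hXZ : X ≠ Z) (hYZ : Y ≠ Z)
    (hX : 4 ≤ pslExp p q X) (hY : 4 ≤ pslExp p q Y) {P₁ Q₁ P₂ Q₂ : SL(2, F) × SL(2, F)}
    (gP₁ : Subgroup.closure {P₁.1, P₁.2} = ⊤) (gQ₁ : Subgroup.closure {Q₁.1, Q₁.2} = ⊤)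
    (gP₂ : Subgroup.closure {P₂.1, P₂.2} = ⊤) (gQ₂ : Subgroup.closure {Q₂.1, Q₂.2} = ⊤)
    (oP₁ : HasOrders P₁ fun _ => pslExp p q X)
    (oQ₁ : HasOrders Q₁ fun s => pslExp p q (![X, X, Y] s))
    (oP₂ : HasOrders P₂ fun _ => pslExp p q Y)
    (oQ₂ : HasOrders Q₂ fun s => pslExp p q (![Y, Y, Z] s)) :
    HasBeauvillePowers PSL(2, F) 1 := by
  have : IsSimpleGroup PSL(2, F) :=
    Matrix.ProjectiveSpecialLinearGroup.rank_two_simple (by rw [Nat.card_eq_fintype_card]; omega)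
  obtain ⟨f, hp, hf⟩ := FiniteField.card F p
  have hne : ∀ c, pslExp p q c ≠ 1 := by
    have h1 := Nat.gcd_le_left (q - 1) two_pos
    have h2 := Nat.gcd_le_left (q + 1) two_pos
    have h3 : 2 ≤ (q - 1) / Nat.gcd 2 (q - 1) := by
      rw [Nat.le_div_iff_mul_le (Nat.gcd_pos_of_pos_left _ two_pos)]
      omega
    have h4 : 2 ≤ (q + 1) / Nat.gcd 2 (q + 1) := by
      rw [Nat.le_div_iff_mul_le (Nat.gcd_pos_of_pos_left _ two_pos)]
      omega
    intro c
    fin_cases c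
    · exact hp.one_lt.ne'
    · exact (show 1 < _ from h3).ne'
    · exact (show 1 < _ from h4).ne'
  have cop : ∀ c c', c ≠ c' → (pslExp p q c).Coprime (pslExp p q c') := by
    rw [← hF, hf]
    exact pslExp_coprime hp f.ne_zero
  have cover : ∀ h : PSL(2, F), ∃ c, h ^ pslExp p q c = 1 := fun h => by
    rw [← hF]
    exact pslExp_cover h
  have o₁ : ∀ s, orderOf (slot (toPSL F P₁.1, toPSL F P₁.2) s) = pslExp p q X :=
    fun s => oP₁.orderOf_eq s
  have o₂ : ∀ s, orderOf (slot (toPSL F Q₁.1, toPSL F Q₁.2) s) = pslExp p q (![X, X, Y] s) :=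
    fun s => oQ₁.orderOf_eq s
  have o₃ : ∀ s, orderOf (slot (toPSL F P₂.1, toPSL F P₂.2) s) = pslExp p q Y :=
    fun s => oP₂.orderOf_eq s
  have o₄ : ∀ s, orderOf (slot (toPSL F Q₂.1, toPSL F Q₂.2) s) = pslExp p q (![Y, Y, Z] s) :=
    fun s => oQ₂.orderOf_eq s
  exact hasBeauvillePowers_of_corners (e := pslExp p q) (P₁ := (toPSL F P₁.1, toPSL F P₁.2))
    (Q₁ := (toPSL F Q₁.1, toPSL F Q₁.2)) (P₂ := (toPSL F P₂.1, toPSL F P₂.2))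
    (Q₂ := (toPSL F Q₂.1, toPSL F Q₂.2)) (exists_mul_ne_mul_PSL F) cop cover hne
    hXY hXZ hYZ hX hY (closure_toPSL_eq_top gP₁) (closure_toPSL_eq_top gQ₁)
    (closure_toPSL_eq_top gP₂) (closure_toPSL_eq_top gQ₂) o₁ o₂ o₃ o₄
theorem closure_eq_top_of_word {P : SL(2, F) × SL(2, F)}
    (hR : unipotentScalars (Subgroup.closure {P.1, P.2}) = ⊤) (l : List Bool)
    (h : evalWord P l = upper 1 ∧ (P.1 1 0 ≠ 0 ∨ P.2 1 0 ≠ 0)) :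
    Subgroup.closure {P.1, P.2} = ⊤ := by
  have hu := h.1 ▸ evalWord_mem P l
  rcases h.2 with h | h
  · exact eq_top_of_unipotentScalars hR one_ne_zero hu (Subgroup.subset_closure (Or.inl rfl)) h
  · exact eq_top_of_unipotentScalars hR one_ne_zero hu (Subgroup.subset_closure (Or.inr rfl)) h

theorem closure_eq_top_of_word_zmod {p : ℕ} [Fact p.Prime] {P : SL(2, ZMod p) × SL(2, ZMod p)}
    (l : List Bool) (h : evalWord P l = upper 1 ∧ (P.1 1 0 ≠ 0 ∨ P.2 1 0 ≠ 0)) :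
    Subgroup.closure {P.1, P.2} = ⊤ := by
  refine closure_eq_top_of_word (eq_top_iff.2 fun a _ => ?_) l h
  rw [← ZMod.natCast_zmod_val a]
  exact natCast_mem _ _

theorem closure_eq_top_of_words_of_card [Fintype F] {P : SL(2, F) × SL(2, F)} (l l' : List Bool)
    (h : evalWord P l = upper 1 ∧ (P.1 1 0 ≠ 0 ∨ P.2 1 0 ≠ 0)) (h' : evalWord P l' 1 0 = 0)
    (ho : orderOf (evalWord P l' 0 0) = Fintype.card F - 1) : Subgroup.closure {P.1, P.2} = ⊤ :=
  closure_eq_top_of_word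
    (Subring.eq_top_of_sq_mem ho (sq_mem_unipotentScalars (evalWord_mem P l') h')) l h

instance : Fact (Nat.Prime 7) := ⟨Nat.prime_seven⟩
instance : Fact (Nat.Prime 11) := ⟨Nat.prime_eleven⟩
instance : Fact (Nat.Prime 13) := ⟨by norm_num⟩

theorem hasBeauvillePowers_PSL_seven : HasBeauvillePowers PSL(2, ZMod 7) 1 :=
  hasBeauvillePowers_PSL_of_corners (p := 7) (q := 7) (ZMod.card 7) (by norm_num)
    (X := 2) (Y := 0) (Z := 1) (by decide) (by decide) (by decide) (by decide) (by decide)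
    (P₁ := (mkSL2 6 5 6 4 (by decide), mkSL2 4 3 3 6 (by decide)))
    (Q₁ := (mkSL2 6 5 6 4 (by decide), mkSL2 4 6 1 0 (by decide)))
    (P₂ := (mkSL2 1 1 0 1 (by decide), mkSL2 4 4 3 5 (by decide)))
    (Q₂ := (mkSL2 3 6 4 6 (by decide), mkSL2 1 1 0 1 (by decide)))
    (closure_eq_top_of_word_zmod [true, true, false] (by decide +kernel))
    (closure_eq_top_of_word_zmod [true, false] (by decide +kernel))
    (closure_eq_top_of_word_zmod [true] (by decide +kernel))
    (closure_eq_top_of_word_zmod [false] (by decide +kernel))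
    (by decide +kernel) (by decide +kernel) (by decide +kernel) (by decide +kernel)

theorem hasBeauvillePowers_PSL_eleven : HasBeauvillePowers PSL(2, ZMod 11) 1 :=
  hasBeauvillePowers_PSL_of_corners (p := 11) (q := 11) (ZMod.card 11) (by norm_num)
    (X := 1) (Y := 0) (Z := 2) (by decide) (by decide) (by decide) (by decide) (by decide)
    (P₁ := (mkSL2 10 5 1 5 (by decide), mkSL2 7 0 8 8 (by decide)))
    (Q₁ := (mkSL2 9 8 8 6 (by decide), mkSL2 5 8 10 3 (by decide)))
    (P₂ := (mkSL2 1 1 0 1 (by decide), mkSL2 4 2 4 5 (by decide)))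
    (Q₂ := (mkSL2 1 1 0 1 (by decide), mkSL2 3 10 4 10 (by decide)))
    (closure_eq_top_of_word_zmod [true, false, false] (by decide +kernel))
    (closure_eq_top_of_word_zmod [true, false, false] (by decide +kernel))
    (closure_eq_top_of_word_zmod [true] (by decide +kernel))
    (closure_eq_top_of_word_zmod [true] (by decide +kernel))
    (by decide +kernel) (by decide +kernel) (by decide +kernel) (by decide +kernel)

theorem hasBeauvillePowers_PSL_thirteen : HasBeauvillePowers PSL(2, ZMod 13) 1 :=
  hasBeauvillePowers_PSL_of_corners (p := 13) (q := 13) (ZMod.card 13) (by norm_num)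
    (X := 1) (Y := 0) (Z := 2) (by decide) (by decide) (by decide) (by decide) (by decide)
    (P₁ := (mkSL2 8 3 11 1 (by decide), mkSL2 7 6 5 10 (by decide)))
    (Q₁ := (mkSL2 0 4 3 4 (by decide), mkSL2 9 2 3 8 (by decide)))
    (P₂ := (mkSL2 0 3 4 11 (by decide), mkSL2 1 1 0 1 (by decide)))
    (Q₂ := (mkSL2 1 1 0 1 (by decide), mkSL2 12 0 8 12 (by decide)))
    (closure_eq_top_of_word_zmod [true, true, true, true, false] (by decide +kernel))
    (closure_eq_top_of_word_zmod [true, false, true, false] (by decide +kernel))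
    (closure_eq_top_of_word_zmod [false] (by decide +kernel))
    (closure_eq_top_of_word_zmod [true] (by decide +kernel))
    (by decide +kernel) (by decide +kernel) (by decide +kernel) (by decide +kernel)

/-- The field with nine elements, as `𝔽₃(i)`. -/
abbrev NineField : Type := QuadraticAlgebra (ZMod 3) (-1) 0

instance : Fact (∀ r : ZMod 3, r ^ 2 ≠ -1 + 0 * r) := ⟨by decide⟩

instance : Fintype NineField := Fintype.ofEquiv _ (QuadraticAlgebra.equivProd (-1 : ZMod 3) 0).symm

theorem card_nineField : Fintype.card NineField = 9 := by
  rw [Fintype.card_congr (QuadraticAlgebra.equivProd (-1 : ZMod 3) 0), Fintype.card_prod, ZMod.card]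

instance : CharP NineField 3 := by
  exact charP_of_injective_algebraMap (FaithfulSMul.algebraMap_injective (ZMod 3) NineField) 3

theorem closure_eq_top_of_words_nine {P : SL(2, NineField) × SL(2, NineField)} (l l' : List Bool)
    (h : (evalWord P l = upper 1 ∧ (P.1 1 0 ≠ 0 ∨ P.2 1 0 ≠ 0)) ∧ evalWord P l' 1 0 = 0 ∧
      evalWord P l' 0 0 ^ 8 = 1 ∧ ∀ m < 8, 0 < m → evalWord P l' 0 0 ^ m ≠ 1) :
    Subgroup.closure {P.1, P.2} = ⊤ :=
  closure_eq_top_of_words_of_card l l' h.1 h.2.1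
    (by rw [card_nineField]; exact (orderOf_eq_iff (by norm_num)).2 h.2.2)

theorem hasBeauvillePowers_PSL_nine : HasBeauvillePowers PSL(2, NineField) 1 :=
  hasBeauvillePowers_PSL_of_corners (p := 3) (q := 9) card_nineField (by norm_num)
    (X := 1) (Y := 2) (Z := 0) (by decide) (by decide) (by decide) (by decide) (by decide)
    (P₁ := (mkSL2 ⟨2, 0⟩ ⟨0, 1⟩ ⟨2, 2⟩ ⟨1, 1⟩ (by decide +kernel),
      mkSL2 ⟨2, 1⟩ ⟨2, 1⟩ ⟨0, 0⟩ ⟨1, 1⟩ (by decide +kernel)))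
    (Q₁ := (mkSL2 ⟨1, 1⟩ ⟨0, 2⟩ ⟨0, 0⟩ ⟨2, 1⟩ (by decide +kernel),
      mkSL2 ⟨2, 0⟩ ⟨1, 1⟩ ⟨0, 2⟩ ⟨1, 1⟩ (by decide +kernel)))
    (P₂ := (mkSL2 ⟨1, 2⟩ ⟨0, 2⟩ ⟨1, 0⟩ ⟨1, 0⟩ (by decide +kernel),
      mkSL2 ⟨1, 0⟩ ⟨1, 2⟩ ⟨1, 2⟩ ⟨1, 1⟩ (by decide +kernel)))
    (Q₂ := (mkSL2 ⟨1, 0⟩ ⟨0, 1⟩ ⟨2, 0⟩ ⟨1, 2⟩ (by decide +kernel),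
      mkSL2 ⟨2, 0⟩ ⟨2, 2⟩ ⟨1, 0⟩ ⟨0, 1⟩ (by decide +kernel)))
    (closure_eq_top_of_words_nine [true, false, true, false, false, true] [false] (by decide +kernel))
    (closure_eq_top_of_words_nine [false, true, true, false, false] [true] (by decide +kernel))
    (closure_eq_top_of_words_nine [true, false, false, true, true, false] [true, false, true] (by decide +kernel))
    (closure_eq_top_of_words_nine [true, true, true, true, false] [true, false, true] (by decide +kernel))
    (by decide +kernel) (by decide +kernel) (by decide +kernel) (by decide +kernel)

end SmallFields

section Main

variable {F : Type*} [Field F] [Fintype F]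

theorem hasBeauvillePowers_PSL_of_card_eq {F' : Type*} [Field F'] [Fintype F']
    (h : Fintype.card F = Fintype.card F') {k₀ : ℕ} (h' : HasBeauvillePowers PSL(2, F') k₀) :
    HasBeauvillePowers PSL(2, F) k₀ := by
  obtain ⟨φ⟩ := nonempty_PSL_mulEquiv_of_card h.symm
  exact h'.congr φ

theorem hasBeauvillePowers_PSL (hq : 6 ≤ Fintype.card F) : HasBeauvillePowers PSL(2, F) 1 := by
  by_cases h : Fintype.card F = 8 ∨ 16 ≤ Fintype.card F
  · exact hasBeauvillePowers_PSL_of_generic h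
  have hpp : IsPrimePow (Fintype.card F) := FiniteField.isPrimePow_card F
  obtain h7 | h9 | h11 | h13 : Fintype.card F = 7 ∨ Fintype.card F = 9 ∨ Fintype.card F = 11 ∨
      Fintype.card F = 13 := by
    have : Fintype.card F < 16 := by omega
    generalize Fintype.card F = q at *
    interval_cases q <;> first | omega | (exfalso; revert hpp; decide +kernel)
  · exact hasBeauvillePowers_PSL_of_card_eq (h7.trans (ZMod.card 7).symm)
      hasBeauvillePowers_PSL_seven
  · exact hasBeauvillePowers_PSL_of_card_eq (h9.trans card_nineField.symm)
      hasBeauvillePowers_PSL_nine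
  · exact hasBeauvillePowers_PSL_of_card_eq (h11.trans (ZMod.card 11).symm)
      hasBeauvillePowers_PSL_eleven
  · exact hasBeauvillePowers_PSL_of_card_eq (h13.trans (ZMod.card 13).symm)
      hasBeauvillePowers_PSL_thirteen

end Main

/-- Theorem 1 (L₂(q)): for `H = PSL₂(F_q)` with `q ≥ 4` a prime power and `G = Hᵏ`, `k ≥ 1`,
the following are equivalent: (a) `G` admits an unmixed Beauville structure;
(b) `G` is 2-generated and not isomorphic to `A₅`;
(c) `k·|Aut H| ≤ φ₂(H)`, and `k > 1` whenever `q ≤ 5`. -/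
theorem beauville_psl2_tfae (F : Type*) [Field F] [Fintype F] (hq : 4 ≤ Fintype.card F)
    (k : ℕ) (hk : 1 ≤ k) :
    List.TFAE
      [ HasBeauvilleStructure (Fin k → PSL(2, F)),
        (∃ x y : Fin k → PSL(2, F), Subgroup.closure {x, y} = ⊤) ∧
          ¬ Nonempty ((Fin k → PSL(2, F)) ≃* alternatingGroup (Fin 5)),
        k * Nat.card (MulAut PSL(2, F)) ≤ phi2 PSL(2, F) ∧
          (Fintype.card F ≤ 5 → 1 < k) ] := by
  have : IsSimpleGroup PSL(2, F) :=
    Matrix.ProjectiveSpecialLinearGroup.rank_two_simple (by rwa [Nat.card_eq_fintype_card])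
  tfae_have 1 → 2 := fun h =>
    ⟨h.exists_pair, fun ⟨e⟩ => not_hasBeauvilleStructure_of_mulEquiv e h⟩
  tfae_have 2 → 3 := by
    rintro ⟨⟨x, y, h⟩, hA⟩
    refine ⟨card_mul_card_mulAut_le_phi2_of_closure k x y h, fun h5 => ?_⟩
    by_contra hk'
    obtain rfl : k = 1 := by omega
    obtain ⟨e⟩ := PSL_mulEquiv_alternatingGroup_five hq h5
    exact hA ⟨(MulEquiv.funUnique (Fin 1) _).trans e⟩
  tfae_have 3 → 1 := by
    rintro ⟨h, h5⟩
    by_cases hq5 : Fintype.card F ≤ 5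
    · obtain ⟨e⟩ := PSL_mulEquiv_alternatingGroup_five hq hq5
      exact hasBeauvillePowers_alternatingGroup_five.congr e.symm k (h5 hq5) h
    · exact hasBeauvillePowers_PSL (by omega) k hk h
  tfae_finish
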